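/- arXiv:2202.01632 — 3 statements merged into one kernel-verified Lean document; each statement's English description precedes it below -/
import Mathlib

section
/- For μ^ℕ-almost every x ∈ Ω^ℕ, x is Poisson generic; that is, for every real λ > 0 and every i ∈ ℕ₀, lim_{k→∞} Z^λ_{i,k}(x) = e^{-λ} λ^i / i!. -/
open MeasureTheory Filter

/-- The uniform product measure μ^k on Ω^k, Ω = Fin b: normalized counting measure. -/
noncomputable def muK (b k : ℕ) : Measure (Fin k → Fin b) :=
  ((b : ENNReal) ^ k)⁻¹ • Measure.count

/-- ν is the product μ^ℕ of uniform measures on Ω = Fin b over Ω^ℕ: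
every cylinder of length n has measure b^{-n}. -/
def IsUnifProductMeasure (b : ℕ) (ν : Measure (ℕ → Fin b)) : Prop :=
  ∀ (n : ℕ) (w : Fin n → Fin b),
    ν {x | ∀ t : Fin n, x (t : ℕ) = w t} = ((b : ENNReal)⁻¹) ^ n

/-- The word w (of length k) occurs in x at position j (positions numbered from 1). -/
def OccursAt {b k : ℕ} (x : ℕ → Fin b) (j : ℕ) (w : Fin k → Fin b) : Prop :=
  ∀ t : Fin k, x (j - 1 + (t : ℕ)) = w t

instance {b k : ℕ} (x : ℕ → Fin b) (j : ℕ) (w : Fin k → Fin b) :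
    Decidable (OccursAt x j w) := by unfold OccursAt; infer_instance

/-- M_k^x(S)(ω) = Σ_{j ∈ ℕ ∩ b^k S} I_j(x,ω): the number of positive integers j with
j/b^k ∈ S at which ω occurs in x. -/
noncomputable def Mx (b k : ℕ) (S : Set ℝ) (x : ℕ → Fin b) (w : Fin k → Fin b) : ℕ :=
  {j : ℕ | 1 ≤ j ∧ ((j : ℝ) / (b : ℝ) ^ k) ∈ S ∧ OccursAt x j w}.ncard

/-- Z^λ_{i,k}(x): proportion of words of length k occurring exactly i times
among positions 1 ≤ j ≤ λ b^k of x. -/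
noncomputable def Z (b k i : ℕ) (lam : ℝ) (x : ℕ → Fin b) : ℝ :=
  ((Finset.univ.filter (fun w : Fin k → Fin b =>
      ((Finset.Icc 1 ⌊lam * (b : ℝ) ^ k⌋₊).filter (fun j => OccursAt x j w)).card = i)).card : ℝ)
    / (b : ℝ) ^ k

/-- x is λ-Poisson generic. -/
def LamPoissonGeneric (b : ℕ) (lam : ℝ) (x : ℕ → Fin b) : Prop :=
  ∀ i : ℕ, Tendsto (fun k : ℕ => Z b k i lam x) atTop
    (nhds (Real.exp (-lam) * lam ^ i / (Nat.factorial i : ℝ)))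

/-- x is Poisson generic. -/
def PoissonGeneric (b : ℕ) (x : ℕ → Fin b) : Prop :=
  ∀ lam : ℝ, 0 < lam → LamPoissonGeneric b lam x

open Finset BigOperators Topology

/-! ### Elementary inequalities -/

lemma abs_pow_sub_pow_le_mul {a c : ℝ} (ha : 0 ≤ a) (ha' : a ≤ 1) (hc : 0 ≤ c) (hc' : c ≤ 1)
    (m : ℕ) : |a ^ m - c ^ m| ≤ m * |a - c| := by
  induction m with
  | zero => simp
  | succ m ih =>
    have h : a ^ (m + 1) - c ^ (m + 1) = a * (a ^ m - c ^ m) + c ^ m * (a - c) := by ring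
    rw [h]
    refine (abs_add_le _ _).trans ?_
    rw [abs_mul, abs_mul, abs_of_nonneg ha, abs_of_nonneg (pow_nonneg hc m)]
    have h1 := mul_le_mul ha' ih (abs_nonneg _) zero_le_one
    have h2 := mul_le_of_le_one_left (abs_nonneg (a - c)) (pow_le_one₀ hc hc' : c ^ m ≤ 1)
    push_cast
    linarith

lemma one_sub_pow_le_natCast {s : ℝ} (hs : 0 ≤ s) (n : ℕ) : 1 - s ^ n ≤ n * (1 - s) := by
  have := one_add_mul_le_pow (a := s - 1) (by linarith) n
  rw [add_sub_cancel] at this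
  linarith

lemma pow_sub_pow_le_natCast_sub {s : ℝ} (hs : 0 ≤ s) (hs' : s ≤ 1) {m n : ℕ} (h : m ≤ n) :
    s ^ m - s ^ n ≤ (n : ℝ) - m := by
  obtain ⟨d, rfl⟩ := Nat.exists_eq_add_of_le h
  have h1 : s ^ m - s ^ (m + d) = s ^ m * (1 - s ^ d) := by ring
  have h2 : 0 ≤ 1 - s ^ d := sub_nonneg.2 (pow_le_one₀ hs hs')
  have h3 := mul_le_of_le_one_left h2 (pow_le_one₀ hs hs' : s ^ m ≤ 1)
  have h4 := one_sub_pow_le_natCast hs d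
  have h5 : (d : ℝ) * (1 - s) ≤ d := mul_le_of_le_one_right (Nat.cast_nonneg d) (by linarith)
  push_cast
  linarith

lemma pow_sub_linear_le {s : ℝ} (hs : 0 ≤ s) (hs' : s ≤ 1) (n : ℕ) :
    s ^ n - 1 + (1 - s) * n ≤ (n : ℝ) * n - n := by
  induction n with
  | zero => simp
  | succ n ih =>
    have h0 : 0 ≤ s ^ n - 1 + (1 - s) * n := by linarith [one_sub_pow_le_natCast hs n]
    have h1 := mul_le_of_le_one_left h0 hs'
    have h2 : (1 - s) ^ 2 * n ≤ n :=
      mul_le_of_le_one_left (Nat.cast_nonneg n) (pow_le_one₀ (by linarith) (by linarith))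
    have h3 : s ^ (n + 1) - 1 + (1 - s) * ((n + 1 : ℕ) : ℝ)
        = s * (s ^ n - 1 + (1 - s) * n) + (1 - s) ^ 2 * n := by push_cast; ring
    rw [h3]
    push_cast
    nlinarith

lemma abs_pow_mul_pow_sub_linear_le {s t : ℝ} (hs : 0 ≤ s) (hs' : s ≤ 1) (ht : 0 ≤ t)
    (ht' : t ≤ 1) (m n : ℕ) :
    |s ^ m * t ^ n - (1 - (1 - s) * m - (1 - t) * n)|
      ≤ ((m : ℝ) * m - m) + ((n : ℝ) * n - n) + m * n := by
  have h1 := pow_sub_linear_le hs hs' m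
  have h2 := pow_sub_linear_le ht ht' n
  have h3 := one_sub_pow_le_natCast hs m
  have h4 := one_sub_pow_le_natCast ht n
  have h5 : 0 ≤ 1 - s ^ m := sub_nonneg.2 (pow_le_one₀ hs hs')
  have h6 : 0 ≤ 1 - t ^ n := sub_nonneg.2 (pow_le_one₀ ht ht')
  have h7 : (m : ℝ) * (1 - s) ≤ m := mul_le_of_le_one_right (Nat.cast_nonneg m) (by linarith)
  have h8 : (n : ℝ) * (1 - t) ≤ n := mul_le_of_le_one_right (Nat.cast_nonneg n) (by linarith)
  have h9 : (1 - s ^ m) * (1 - t ^ n) ≤ m * n :=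
    mul_le_mul (by linarith) (by linarith) h6 (Nat.cast_nonneg m)
  have h10 := mul_nonneg h5 h6
  rw [abs_le]
  constructor <;> nlinarith

lemma abs_one_sub_sub_exp_neg_le {u : ℝ} (hu : 0 ≤ u) : |1 - u - Real.exp (-u)| ≤ u ^ 2 := by
  have h1 := Real.one_sub_le_exp_neg u
  have h2 : Real.exp (-u) ≤ (1 + u)⁻¹ := by
    rw [Real.exp_neg]
    exact inv_anti₀ (by linarith) (by linarith [Real.add_one_le_exp u])
  have h3 : (1 + u)⁻¹ ≤ 1 - u + u ^ 2 := by
    rw [inv_le_iff_one_le_mul₀ (by linarith)]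
    nlinarith [pow_nonneg hu 3]
  rw [abs_le]
  constructor <;> linarith

/-! ### Windows of a finite block -/

lemma expect_card_filter_eq {ι W : Type*} [Fintype W] [DecidableEq W] [Nonempty W]
    (S : Finset ι) (f : ι → W) :
    𝔼 w : W, ((S.filter fun j => f j = w).card : ℝ) = S.card / Fintype.card W := by
  rw [Fintype.expect_eq_sum_div_card]
  congr 1
  rw [← Nat.cast_sum, ← card_eq_sum_card_fiberwise (fun x _ => mem_univ (f x))]

lemma expect_card_filter_eq_sq {ι W : Type*} [Fintype W] [DecidableEq W] [Nonempty W]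
    (S : Finset ι) (f : ι → W) :
    𝔼 w : W, ((S.filter fun j => f j = w).card : ℝ) ^ 2
      = (∑ j ∈ S, ∑ l ∈ S, if f j = f l then 1 else 0) / Fintype.card W := by
  rw [Fintype.expect_eq_sum_div_card]
  congr 1
  simp_rw [card_filter, Nat.cast_sum, sq, sum_mul_sum]
  rw [sum_comm]
  refine sum_congr rfl fun j _ => ?_
  rw [sum_comm]
  refine sum_congr rfl fun l _ => ?_
  rw [sum_eq_single (f j)]
  · simp [eq_comm]
  · intro w _ hw
    simp [hw.symm]
  · simp

/-- The word of length `k` starting at place `j` of a block of length `L + k`. -/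
def window {b L k : ℕ} (y : Fin (L + k) → Fin b) (j : Fin L) : Fin k → Fin b :=
  fun t => y ⟨j + t, by omega⟩

/-- The number of places `j < L` of a block of length `L + k` at which `w` starts. -/
def blockCount {b L k : ℕ} (y : Fin (L + k) → Fin b) (w : Fin k → Fin b) : ℕ :=
  (univ.filter fun j : Fin L => window y j = w).card

/-- The places of the window starting at `j`. -/
def windowPlaces {L : ℕ} (k : ℕ) (j : Fin L) : Finset (Fin (L + k)) :=
  univ.map ⟨fun t : Fin k => ⟨j + t, by omega⟩, fun s t h => by
    simpa [Fin.ext_iff] using h⟩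

lemma card_compl_windowPlaces {L : ℕ} (k : ℕ) (j : Fin L) :
    Fintype.card {p // p ∉ windowPlaces k j} = L := by
  rw [Fintype.card_subtype_compl, Fintype.card_coe, windowPlaces, card_map]
  simp

lemma card_filter_le_of_determined {b L k : ℕ} (j : Fin L) (P : (Fin (L + k) → Fin b) → Prop)
    [DecidablePred P]
    (hP : ∀ y z, P y → P z → (∀ p ∉ windowPlaces k j, y p = z p) → y = z) :
    (univ.filter P).card ≤ b ^ L := by
  have h : Fintype.card ({p // p ∉ windowPlaces k j} → Fin b) = b ^ L := by
    rw [Fintype.card_fun, card_compl_windowPlaces, Fintype.card_fin]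
  rw [← h, ← card_univ]
  refine card_le_card_of_injOn (fun y p => y p.1) (fun _ _ => mem_coe.2 (mem_univ _)) ?_
  intro y hy z hz hyz
  simp only [coe_filter, mem_univ, true_and, Set.mem_ofPred_eq] at hy hz
  exact hP y z hy hz fun p hp => congrFun hyz ⟨p, hp⟩

lemma card_window_eq_le {b L k : ℕ} (j : Fin L) (w : Fin k → Fin b) :
    (univ.filter fun y : Fin (L + k) → Fin b => window y j = w).card ≤ b ^ L := by
  refine card_filter_le_of_determined j _ fun y z hy hz h => funext fun p => ?_
  by_cases hp : p ∈ windowPlaces k j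
  · simp only [windowPlaces, Finset.mem_map, mem_univ, true_and] at hp
    obtain ⟨t, rfl⟩ := hp
    exact congrFun (hy.trans hz.symm) t
  · exact h p hp

lemma card_window_eq {b L k : ℕ} (j : Fin L) (w : Fin k → Fin b) :
    (univ.filter fun y : Fin (L + k) → Fin b => window y j = w).card = b ^ L := by
  have hsum : ∑ w : Fin k → Fin b,
      (univ.filter fun y : Fin (L + k) → Fin b => window y j = w).card
        = ∑ _w : Fin k → Fin b, b ^ L := by
    rw [← card_eq_sum_card_fiberwise (fun y _ => mem_univ (window y j))]
    simp [pow_add, mul_comm]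
  exact (sum_eq_sum_iff_of_le fun w _ => card_window_eq_le j w).1 hsum w (mem_univ w)

lemma card_window_eq_window_le {b L k : ℕ} {j l : Fin L} (hjl : j ≠ l) :
    (univ.filter fun y : Fin (L + k) → Fin b => window y j = window y l).card ≤ b ^ L := by
  wlog hlt : j < l generalizing j l
  · simp_rw [eq_comm (a := window _ j)]
    exact this hjl.symm (lt_of_le_of_ne (not_lt.1 hlt) hjl.symm)
  refine card_filter_le_of_determined l _ fun y z hy hz h => ?_
  have key : ∀ n (hn : n < L + k), y ⟨n, hn⟩ = z ⟨n, hn⟩ := by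
    intro n
    induction n using Nat.strong_induction_on with
    | _ n ih =>
      intro hn
      by_cases hp : (⟨n, hn⟩ : Fin (L + k)) ∈ windowPlaces k l
      · simp only [windowPlaces, Finset.mem_map, mem_univ, true_and] at hp
        obtain ⟨t, ht⟩ := hp
        obtain rfl : (l : ℕ) + t = n := congrArg Fin.val ht
        have hy' := congrFun hy t
        have hz' := congrFun hz t
        simp only [window] at hy' hz'
        rw [← hy', ← hz']
        exact ih _ (by have : (j : ℕ) < l := hlt
                       omega) _
      · exact h _ hp
  exact funext fun p => key p p.2

section Block

variable {b L k : ℕ} [NeZero b]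

lemma expect_blockCount_word (y : Fin (L + k) → Fin b) :
    𝔼 w : Fin k → Fin b, (blockCount y w : ℝ) = L / (b : ℝ) ^ k := by
  simp [blockCount, expect_card_filter_eq]

lemma expect_blockCount_block (w : Fin k → Fin b) :
    𝔼 y : Fin (L + k) → Fin b, (blockCount y w : ℝ) = L / (b : ℝ) ^ k := by
  have hb : (b : ℝ) ≠ 0 := Nat.cast_ne_zero.2 (NeZero.ne b)
  rw [Fintype.expect_eq_sum_div_card]
  simp_rw [blockCount, card_filter, Nat.cast_sum]
  rw [sum_comm]
  have : ∀ j : Fin L, ∑ y : Fin (L + k) → Fin b, (((if window y j = w then 1 else 0 : ℕ)) : ℝ)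
      = (b : ℝ) ^ L := by
    intro j
    rw [← Nat.cast_sum, ← card_filter, card_window_eq]
    push_cast; rfl
  simp only [this]
  simp [pow_add]
  field_simp

lemma expect_expect_blockCount_sq_sub_le :
    𝔼 y : Fin (L + k) → Fin b, 𝔼 w : Fin k → Fin b,
      ((blockCount y w : ℝ) * blockCount y w - blockCount y w) ≤ (L / (b : ℝ) ^ k) ^ 2 := by
  have hb : (0 : ℝ) < b := Nat.cast_pos.2 (NeZero.pos b)
  have h1 : ∀ y : Fin (L + k) → Fin b, 𝔼 w : Fin k → Fin b,
      ((blockCount y w : ℝ) * blockCount y w - blockCount y w)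
      = (∑ j : Fin L, ∑ l : Fin L, if j ≠ l ∧ window y j = window y l then 1 else 0)
          / (b : ℝ) ^ k := by
    intro y
    rw [expect_sub_distrib, expect_blockCount_word]
    simp_rw [← sq]
    simp only [blockCount]
    rw [expect_card_filter_eq_sq]
    simp only [Fintype.card_fun, Fintype.card_fin, Nat.cast_pow]
    rw [← sub_div]
    congr 1
    rw [sub_eq_iff_eq_add]
    have : (L : ℝ) = ∑ j : Fin L, ∑ l : Fin L, if j = l then 1 else 0 := by simp
    rw [this, ← sum_add_distrib]
    refine sum_congr rfl fun j _ => ?_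
    rw [← sum_add_distrib]
    refine sum_congr rfl fun l _ => ?_
    by_cases h : j = l <;> simp [h]
  simp_rw [h1]
  rw [Fintype.expect_eq_sum_div_card, ← sum_div, sum_comm]
  have h2 : ∀ j : Fin L, ∑ y : Fin (L + k) → Fin b, ∑ l : Fin L,
      (if j ≠ l ∧ window y j = window y l then (1 : ℝ) else 0) ≤ L * (b : ℝ) ^ L := by
    intro j
    rw [sum_comm]
    have h3 : ∀ l : Fin L, ∑ y : Fin (L + k) → Fin b,
        (if j ≠ l ∧ window y j = window y l then (1 : ℝ) else 0) ≤ (b : ℝ) ^ L := by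
      intro l
      by_cases h : j = l
      · simp [h]
      · simp only [ne_eq, h, not_false_eq_true, true_and, sum_boole]
        exact_mod_cast card_window_eq_window_le h
    refine (sum_le_sum fun l _ => h3 l).trans ?_
    simp
  have h4 := sum_le_sum fun j (_ : j ∈ (univ : Finset (Fin L))) => h2 j
  simp only [Fintype.card_fun, Fintype.card_fin, Nat.cast_pow]
  calc _ ≤ (∑ _j : Fin L, (L : ℝ) * (b : ℝ) ^ L) / (b : ℝ) ^ k / (b : ℝ) ^ (L + k) := by
        gcongr
    _ = _ := by
        simp [pow_add]
        field_simp

end Block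

/-- The generating function, for a uniformly chosen word, of its number of occurrences in a
family of blocks. -/
noncomputable def blocksPgf {b L k m : ℕ} (s : ℝ) (p : Fin m → Fin (L + k) → Fin b) : ℝ :=
  𝔼 w : Fin k → Fin b, s ^ ∑ i, blockCount (p i) w

lemma expect_blocksPgf_mul {b L k m : ℕ} (s t : ℝ) :
    𝔼 p : Fin m → Fin (L + k) → Fin b, blocksPgf s p * blocksPgf t p
      = 𝔼 w : Fin k → Fin b, 𝔼 v : Fin k → Fin b,
        (𝔼 y : Fin (L + k) → Fin b, s ^ blockCount y w * t ^ blockCount y v) ^ m := by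
  simp_rw [blocksPgf, expect_mul_expect]
  rw [expect_comm]
  refine expect_congr rfl fun w _ => ?_
  rw [expect_comm]
  refine expect_congr rfl fun v _ => ?_
  rw [expect_pow, Fintype.piFinset_univ]
  simp_rw [prod_mul_distrib, prod_pow_eq_pow_sum]

section Blocks

variable {b L k : ℕ} [NeZero b]

lemma abs_expect_block_sub_exp_le {s t : ℝ} (hs : 0 ≤ s) (hs' : s ≤ 1) (ht : 0 ≤ t)
    (ht' : t ≤ 1) (w v : Fin k → Fin b) :
    |𝔼 y : Fin (L + k) → Fin b, s ^ blockCount y w * t ^ blockCount y v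
        - Real.exp (-((2 - s - t) * (L / (b : ℝ) ^ k)))|
      ≤ 𝔼 y : Fin (L + k) → Fin b,
          (((blockCount y w : ℝ) * blockCount y w - blockCount y w)
            + ((blockCount y v : ℝ) * blockCount y v - blockCount y v)
            + blockCount y w * blockCount y v) + 4 * (L / (b : ℝ) ^ k) ^ 2 := by
  set r : ℝ := L / (b : ℝ) ^ k with hr
  have hr0 : 0 ≤ r := by positivity
  set u : ℝ := (2 - s - t) * r with hu
  have hu0 : 0 ≤ u := mul_nonneg (by linarith) hr0
  have hlin : 𝔼 y : Fin (L + k) → Fin b,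
      (1 - (1 - s) * (blockCount y w : ℝ) - (1 - t) * (blockCount y v : ℝ)) = 1 - u := by
    rw [expect_sub_distrib, expect_sub_distrib, ← mul_expect, ← mul_expect,
      expect_blockCount_block, expect_blockCount_block, Fintype.expect_const]
    ring
  have h1 : |𝔼 y : Fin (L + k) → Fin b, s ^ blockCount y w * t ^ blockCount y v - (1 - u)|
      ≤ 𝔼 y : Fin (L + k) → Fin b,
          (((blockCount y w : ℝ) * blockCount y w - blockCount y w)
            + ((blockCount y v : ℝ) * blockCount y v - blockCount y v)
            + blockCount y w * blockCount y v) := by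
    rw [← hlin, ← expect_sub_distrib]
    exact (abs_expect_le _ _).trans
      (expect_le_expect fun y _ => abs_pow_mul_pow_sub_linear_le hs hs' ht ht' _ _)
  have h2 := abs_one_sub_sub_exp_neg_le hu0
  have h3 : u ^ 2 ≤ 4 * r ^ 2 := by
    rw [hu, mul_pow]
    exact mul_le_mul_of_nonneg_right (by nlinarith) (sq_nonneg r)
  have h4 := abs_sub_le (𝔼 y : Fin (L + k) → Fin b, s ^ blockCount y w * t ^ blockCount y v)
    (1 - u) (Real.exp (-u))
  linarith

lemma expect_abs_block_pow_sub_exp_le {s t : ℝ} (hs : 0 ≤ s) (hs' : s ≤ 1) (ht : 0 ≤ t)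
    (ht' : t ≤ 1) (m : ℕ) :
    𝔼 w : Fin k → Fin b, 𝔼 v : Fin k → Fin b,
      |(𝔼 y : Fin (L + k) → Fin b, s ^ blockCount y w * t ^ blockCount y v) ^ m
        - Real.exp (-((2 - s - t) * (m * (L / (b : ℝ) ^ k))))|
      ≤ 7 * (m * (L / (b : ℝ) ^ k) ^ 2) := by
  set r : ℝ := L / (b : ℝ) ^ k with hr
  have hr0 : 0 ≤ r := by positivity
  have hpt : ∀ w v : Fin k → Fin b,
      |(𝔼 y : Fin (L + k) → Fin b, s ^ blockCount y w * t ^ blockCount y v) ^ m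
        - Real.exp (-((2 - s - t) * (m * r)))|
      ≤ m * (𝔼 y : Fin (L + k) → Fin b,
          (((blockCount y w : ℝ) * blockCount y w - blockCount y w)
            + ((blockCount y v : ℝ) * blockCount y v - blockCount y v)
            + blockCount y w * blockCount y v) + 4 * r ^ 2) := by
    intro w v
    have hexp : Real.exp (-((2 - s - t) * (m * r))) = Real.exp (-((2 - s - t) * r)) ^ m := by
      rw [← Real.exp_nat_mul]
      congr 1
      ring
    rw [hexp]
    refine (abs_pow_sub_pow_le_mul ?_ ?_ (Real.exp_pos _).le ?_ m).trans ?_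
    · exact expect_nonneg fun y _ => by positivity
    · exact expect_le univ_nonempty fun y _ =>
        mul_le_one₀ (pow_le_one₀ hs hs') (by positivity) (pow_le_one₀ ht ht')
    · exact Real.exp_le_one_iff.2
        (neg_nonpos.2 (mul_nonneg (by linarith) hr0))
    · exact mul_le_mul_of_nonneg_left (abs_expect_block_sub_exp_le hs hs' ht ht' w v)
        (Nat.cast_nonneg m)
  refine (expect_le_expect fun w _ => expect_le_expect fun v _ => hpt w v).trans ?_
  simp_rw [← mul_expect, expect_add_distrib, Fintype.expect_const]
  have e1 : 𝔼 w : Fin k → Fin b, 𝔼 y : Fin (L + k) → Fin b,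
      ((blockCount y w : ℝ) * blockCount y w - blockCount y w) ≤ r ^ 2 := by
    rw [expect_comm]
    exact expect_expect_blockCount_sq_sub_le
  have e2 : 𝔼 w : Fin k → Fin b, 𝔼 v : Fin k → Fin b, 𝔼 y : Fin (L + k) → Fin b,
      ((blockCount y w : ℝ) * blockCount y v) = r ^ 2 := by
    have : ∀ w : Fin k → Fin b, 𝔼 v : Fin k → Fin b, 𝔼 y : Fin (L + k) → Fin b,
        ((blockCount y w : ℝ) * blockCount y v) = r * r := by
      intro w
      rw [expect_comm]
      simp_rw [← mul_expect, expect_blockCount_word]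
      rw [← expect_mul, expect_blockCount_block]
    simp_rw [this, Fintype.expect_const, sq]
  rw [e2]
  nlinarith [mul_le_mul_of_nonneg_left e1 (Nat.cast_nonneg (α := ℝ) m)]

lemma abs_expect_blocksPgf_mul_sub_exp_le {m : ℕ} {s t : ℝ} (hs : 0 ≤ s) (hs' : s ≤ 1)
    (ht : 0 ≤ t) (ht' : t ≤ 1) :
    |𝔼 p : Fin m → Fin (L + k) → Fin b, blocksPgf s p * blocksPgf t p
        - Real.exp (-((2 - s - t) * (m * (L / (b : ℝ) ^ k))))|
      ≤ 7 * (m * (L / (b : ℝ) ^ k) ^ 2) := by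
  refine le_trans ?_ (expect_abs_block_pow_sub_exp_le hs hs' ht ht' m)
  rw [expect_blocksPgf_mul]
  have h : ∀ c : ℝ, c = 𝔼 _w : Fin k → Fin b, 𝔼 _v : Fin k → Fin b, c := by
    intro c
    simp
  conv_lhs => rw [h (Real.exp _)]
  rw [← expect_sub_distrib]
  refine (abs_expect_le _ _).trans (expect_le_expect fun w _ => ?_)
  rw [← expect_sub_distrib]
  exact abs_expect_le _ _

lemma expect_blocksPgf_sub_sq_le {m : ℕ} {s : ℝ} (hs : 0 ≤ s) (hs' : s ≤ 1) :
    𝔼 p : Fin m → Fin (L + k) → Fin b,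
        (blocksPgf s p - Real.exp (-((1 - s) * (m * (L / (b : ℝ) ^ k))))) ^ 2
      ≤ 21 * (m * (L / (b : ℝ) ^ k) ^ 2) := by
  set a : ℝ := m * (L / (b : ℝ) ^ k) with ha
  have ha0 : 0 ≤ a := by positivity
  set g : ℝ := Real.exp (-((1 - s) * a)) with hg
  have hg0 : 0 ≤ g := (Real.exp_pos _).le
  have hg1 : g ≤ 1 := Real.exp_le_one_iff.2 (neg_nonpos.2 (mul_nonneg (by linarith) ha0))
  have h1 := abs_expect_blocksPgf_mul_sub_exp_le (b := b) (L := L) (k := k) (m := m)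
    hs hs' hs hs'
  have h2 := abs_expect_blocksPgf_mul_sub_exp_le (b := b) (L := L) (k := k) (m := m)
    hs hs' zero_le_one le_rfl
  have hg2 : Real.exp (-((2 - s - s) * a)) = g ^ 2 := by
    rw [hg, ← Real.exp_nat_mul]
    congr 1
    push_cast
    ring
  have hg3 : Real.exp (-((2 - s - 1) * a)) = g := by
    rw [hg]
    congr 1
    ring
  have hone : ∀ p : Fin m → Fin (L + k) → Fin b, blocksPgf 1 p = 1 := by
    intro p
    simp [blocksPgf]
  rw [← ha, hg2] at h1
  rw [← ha, hg3] at h2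
  simp_rw [hone, mul_one] at h2
  have hexpand : 𝔼 p : Fin m → Fin (L + k) → Fin b, (blocksPgf s p - g) ^ 2
      = (𝔼 p : Fin m → Fin (L + k) → Fin b, blocksPgf s p * blocksPgf s p - g ^ 2)
        - 2 * g * (𝔼 p : Fin m → Fin (L + k) → Fin b, blocksPgf s p - g) := by
    have : ∀ p : Fin m → Fin (L + k) → Fin b, (blocksPgf s p - g) ^ 2
        = blocksPgf s p * blocksPgf s p - 2 * g * blocksPgf s p + g ^ 2 := fun p => by ring
    simp_rw [this, expect_add_distrib, expect_sub_distrib, ← mul_expect, Fintype.expect_const]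
    ring
  rw [hexpand]
  have h3 := (abs_le.1 h1).2
  have h4 := (abs_le.1 h2).1
  have h5 := abs_nonneg (𝔼 p : Fin m → Fin (L + k) → Fin b, blocksPgf s p - g)
  nlinarith

end Blocks

/-! ### Passing to the product measure -/

/-- The first `m` consecutive blocks of length `n` of a sequence. -/
def blocks {b : ℕ} (m n : ℕ) (x : ℕ → Fin b) : Fin m → Fin n → Fin b :=
  fun i t => x (t + n * i)

lemma lintegral_blocks {b : ℕ} [NeZero b] {ν : Measure (ℕ → Fin b)}
    (hν : IsUnifProductMeasure b ν) (m n : ℕ) {f : (Fin m → Fin n → Fin b) → ℝ}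
    (hf : ∀ p, 0 ≤ f p) :
    ∫⁻ x, ENNReal.ofReal (f (blocks m n x)) ∂ν = ENNReal.ofReal (𝔼 p, f p) := by
  let e : (Fin (m * n) → Fin b) ≃ (Fin m → Fin n → Fin b) :=
    (Equiv.arrowCongr finProdFinEquiv.symm (Equiv.refl _)).trans (Equiv.curry _ _ _)
  let ρ : (ℕ → Fin b) → (Fin (m * n) → Fin b) := fun x t => x t
  have hρ : Measurable ρ := measurable_pi_lambda _ fun t => measurable_pi_apply _
  have he : ∀ x, blocks m n x = e (ρ x) := fun x => rfl
  have hmap : ∀ y : Fin (m * n) → Fin b, (ν.map ρ) {y}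
      = ENNReal.ofReal (((b : ℝ) ^ (m * n))⁻¹) := by
    intro y
    rw [Measure.map_apply hρ (measurableSet_singleton y)]
    have hset : ρ ⁻¹' {y} = {x | ∀ t : Fin (m * n), x (t : ℕ) = y t} := by
      ext x
      simp [ρ, funext_iff]
    rw [hset, hν, ENNReal.ofReal_inv_of_pos (pow_pos (Nat.cast_pos.2 (NeZero.pos b)) _),
      ENNReal.ofReal_pow (Nat.cast_nonneg b), ENNReal.ofReal_natCast, ENNReal.inv_pow]
  calc ∫⁻ x, ENNReal.ofReal (f (blocks m n x)) ∂ν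
      = ∫⁻ y, ENNReal.ofReal (f (e y)) ∂(ν.map ρ) := by
        rw [lintegral_map (measurable_of_finite _) hρ]
        simp_rw [he]
    _ = ∑ y, ENNReal.ofReal (f (e y) * ((b : ℝ) ^ (m * n))⁻¹) := by
        rw [lintegral_fintype]
        refine sum_congr rfl fun y _ => ?_
        rw [hmap, ENNReal.ofReal_mul (hf _)]
    _ = ENNReal.ofReal (𝔼 p, f p) := by
        rw [← ENNReal.ofReal_sum_of_nonneg fun y _ => mul_nonneg (hf _) (by positivity),
          ← sum_mul, ← Fintype.expect_equiv e (fun y => f (e y)) f fun _ => rfl,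
          Fintype.expect_eq_sum_div_card]
        simp [div_eq_mul_inv]

/-! ### Occurrences in an initial segment -/

/-- The number of places `1 ≤ j ≤ N` at which `w` occurs in `x`. -/
def occCount {b k : ℕ} (N : ℕ) (x : ℕ → Fin b) (w : Fin k → Fin b) : ℕ :=
  ((Icc 1 N).filter fun j => OccursAt x j w).card

/-- The generating function, for a uniformly chosen word of length `k`, of its number of
occurrences at the places `1 ≤ j ≤ N` of `x`. -/
noncomputable def occPgf {b : ℕ} (k N : ℕ) (s : ℝ) (x : ℕ → Fin b) : ℝ :=
  𝔼 w : Fin k → Fin b, s ^ occCount N x w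

lemma expect_occCount {b : ℕ} [NeZero b] (k N : ℕ) (x : ℕ → Fin b) :
    𝔼 w : Fin k → Fin b, (occCount N x w : ℝ) = N / (b : ℝ) ^ k := by
  have h := expect_card_filter_eq (W := Fin k → Fin b) (Icc 1 N) fun j t => x (j - 1 + t)
  simp only [Nat.card_Icc, add_tsub_cancel_right, Fintype.card_fun, Fintype.card_fin,
    Nat.cast_pow] at h
  simp_rw [← h, occCount, OccursAt, funext_iff]

lemma sum_blockCount_le_occCount {b k L m N : ℕ} (h : m * (L + k) ≤ N) (x : ℕ → Fin b)
    (w : Fin k → Fin b) : ∑ i, blockCount (blocks m (L + k) x i) w ≤ occCount N x w := by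
  simp only [blockCount, occCount]
  rw [← card_sigma]
  refine card_le_card_of_injOn (fun q => q.2 + (L + k) * q.1 + 1) ?_ ?_
  · rintro ⟨i, j⟩ hq
    simp only [coe_sigma, Set.mem_sigma_iff, coe_univ, Set.mem_univ, true_and, coe_filter,
      mem_univ, Set.mem_ofPred_eq] at hq
    simp only [coe_filter, mem_Icc, Set.mem_ofPred_eq]
    have hi : (L + k) * (i + 1) ≤ m * (L + k) := by
      rw [mul_comm m]
      exact Nat.mul_le_mul_left _ i.2
    have hj := j.2
    refine ⟨⟨by omega, by rw [mul_add] at hi; omega⟩, fun t => ?_⟩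
    have := congrFun hq t
    simp only [window, blocks] at this
    rw [← this]
    congr 1
    omega
  · rintro ⟨i, j⟩ - ⟨i', j'⟩ - hq
    simp only [add_left_inj] at hq
    have hj : (j : ℕ) < L + k := by omega
    have hj' : (j' : ℕ) < L + k := by omega
    have hpos : 0 < L + k := by omega
    have hii : i = i' := by
      have := congrArg (· / (L + k)) hq
      simp only [Nat.add_mul_div_left _ _ hpos, Nat.div_eq_of_lt hj, Nat.div_eq_of_lt hj',
        zero_add] at this
      exact Fin.ext this
    subst hii
    have hjj : j = j' := Fin.ext (by omega)
    rw [hjj]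

lemma abs_occPgf_sub_blocksPgf_le {b k L m N : ℕ} [NeZero b] (h : m * (L + k) ≤ N) {s : ℝ}
    (hs : 0 ≤ s) (hs' : s ≤ 1) (x : ℕ → Fin b) :
    |occPgf k N s x - blocksPgf s (blocks m (L + k) x)|
      ≤ N / (b : ℝ) ^ k - m * (L / (b : ℝ) ^ k) := by
  have h1 : 𝔼 w : Fin k → Fin b,
      ((occCount N x w : ℝ) - (∑ i, blockCount (blocks m (L + k) x i) w : ℕ))
      = N / (b : ℝ) ^ k - m * (L / (b : ℝ) ^ k) := by
    rw [expect_sub_distrib, expect_occCount]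
    simp_rw [Nat.cast_sum]
    rw [expect_sum_comm]
    simp_rw [expect_blockCount_word]
    simp
  rw [← h1, occPgf, blocksPgf, ← expect_sub_distrib]
  refine (abs_expect_le _ _).trans (expect_le_expect fun w _ => ?_)
  have h2 := sum_blockCount_le_occCount h x w
  rw [abs_sub_comm, abs_of_nonneg (sub_nonneg.2 (pow_le_pow_of_le_one hs hs' h2))]
  exact pow_sub_pow_le_natCast_sub hs hs' h2

/-! ### Almost sure convergence of the generating functions -/

/-- The number of complete blocks of length `k ^ 2 + k` within `λ b ^ k` places. -/
noncomputable def numBlocks (b : ℕ) (lam : ℝ) (k : ℕ) : ℕ :=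
  ⌊lam * (b : ℝ) ^ k⌋₊ / (k ^ 2 + k)

lemma tendsto_nat_pow_atTop
    {b : ℕ} (hb : 2 ≤ b) : Tendsto (fun k : ℕ => (b : ℝ) ^ k) atTop atTop :=
  tendsto_pow_atTop_atTop_of_one_lt (by exact_mod_cast hb)

lemma tendsto_floor_div
    {b : ℕ} (hb : 2 ≤ b) {lam : ℝ} (hlam : 0 ≤ lam) :
    Tendsto (fun k : ℕ => (⌊lam * (b : ℝ) ^ k⌋₊ : ℝ) / (b : ℝ) ^ k) atTop (𝓝 lam) :=
  (tendsto_nat_floor_mul_div_atTop hlam).comp (tendsto_nat_pow_atTop hb)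

lemma tendsto_numBlocks_mul
    {b : ℕ} (hb : 2 ≤ b) {lam : ℝ} (hlam : 0 ≤ lam) :
    Tendsto (fun k : ℕ => (numBlocks b lam k : ℝ) * ((k ^ 2 : ℕ) / (b : ℝ) ^ k)) atTop
      (𝓝 lam) := by
  have hb1 : (1 : ℝ) < b := by exact_mod_cast hb
  have hN := tendsto_floor_div hb hlam
  have h1 : Tendsto (fun k : ℕ => (⌊lam * (b : ℝ) ^ k⌋₊ : ℝ) / (b : ℝ) ^ k * (1 / ((k : ℝ) + 1))
      + ((k : ℝ) ^ 2 / (b : ℝ) ^ k + (k : ℝ) ^ 1 / (b : ℝ) ^ k)) atTop (𝓝 0) := by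
    simpa using (hN.mul tendsto_one_div_add_atTop_nhds_zero_nat).add
      ((tendsto_pow_const_div_const_pow_of_one_lt 2 hb1).add
        (tendsto_pow_const_div_const_pow_of_one_lt 1 hb1))
  have h2 : Tendsto (fun k : ℕ => (⌊lam * (b : ℝ) ^ k⌋₊ : ℝ) / (b : ℝ) ^ k
      - (numBlocks b lam k : ℝ) * ((k ^ 2 : ℕ) / (b : ℝ) ^ k)) atTop (𝓝 0) := by
    refine tendsto_of_tendsto_of_tendsto_of_le_of_le' tendsto_const_nhds h1 ?_ ?_
    · refine Eventually.of_forall fun k => ?_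
      have h : numBlocks b lam k * k ^ 2 ≤ ⌊lam * (b : ℝ) ^ k⌋₊ :=
        (Nat.mul_le_mul_left _ (Nat.le_add_right _ _)).trans (Nat.div_mul_le_self _ _)
      rw [sub_nonneg, ← mul_div_assoc]
      gcongr
      exact_mod_cast h
    · filter_upwards [eventually_ge_atTop 1] with k hk
      set N := ⌊lam * (b : ℝ) ^ k⌋₊
      set m := numBlocks b lam k with hm
      have hdiv : (k ^ 2 + k) * m + N % (k ^ 2 + k) = N := Nat.div_add_mod _ _
      have hmod : N % (k ^ 2 + k) < k ^ 2 + k := Nat.mod_lt _ (by positivity)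
      have hA : (N : ℝ) ≤ m * (k : ℝ) ^ 2 + m * k + (k ^ 2 + k) := by
        have : N ≤ m * k ^ 2 + m * k + (k ^ 2 + k) := by nlinarith
        exact_mod_cast this
      have hB : (m : ℝ) * k ≤ N * (1 / ((k : ℝ) + 1)) := by
        rw [mul_one_div, le_div_iff₀ (by positivity)]
        have : m * k * (k + 1) ≤ N :=
          calc m * k * (k + 1) = (k ^ 2 + k) * m := by ring
            _ ≤ N := Nat.le.intro hdiv
        exact_mod_cast this
      have hq : (0 : ℝ) < (b : ℝ) ^ k := by positivity
      have e1 : (N : ℝ) / (b : ℝ) ^ k - (m : ℝ) * ((k ^ 2 : ℕ) / (b : ℝ) ^ k)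
          = (N - m * (k : ℝ) ^ 2) / (b : ℝ) ^ k := by
        push_cast
        ring
      have e2 : (N : ℝ) / (b : ℝ) ^ k * (1 / ((k : ℝ) + 1))
          + ((k : ℝ) ^ 2 / (b : ℝ) ^ k + (k : ℝ) ^ 1 / (b : ℝ) ^ k)
          = (N * (1 / ((k : ℝ) + 1)) + (k ^ 2 + k)) / (b : ℝ) ^ k := by
        ring
      rw [e1, e2]
      gcongr
      linarith
  simpa using hN.sub h2

lemma numBlocks_mul_sq_le
    {b : ℕ} {lam : ℝ} (hlam : 0 ≤ lam) (k : ℕ) (hb0 : 0 < b) :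
    (numBlocks b lam k : ℝ) * ((k ^ 2 : ℕ) / (b : ℝ) ^ k) ^ 2
      ≤ lam * ((k : ℝ) ^ 2 * ((b : ℝ)⁻¹) ^ k) := by
  have hq : (0 : ℝ) < (b : ℝ) ^ k := by positivity
  have h : numBlocks b lam k * k ^ 2 ≤ ⌊lam * (b : ℝ) ^ k⌋₊ :=
    (Nat.mul_le_mul_left _ (Nat.le_add_right _ _)).trans (Nat.div_mul_le_self _ _)
  have h1 : (numBlocks b lam k : ℝ) * (k : ℝ) ^ 2 ≤ lam * (b : ℝ) ^ k :=
    le_trans (by exact_mod_cast h) (Nat.floor_le (by positivity))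
  have e1 : (numBlocks b lam k : ℝ) * ((k ^ 2 : ℕ) / (b : ℝ) ^ k) ^ 2
      = ((numBlocks b lam k : ℝ) * (k : ℝ) ^ 2) * ((k : ℝ) ^ 2 / ((b : ℝ) ^ k) ^ 2) := by
    push_cast
    ring
  have e2 : lam * ((k : ℝ) ^ 2 * ((b : ℝ)⁻¹) ^ k)
      = (lam * (b : ℝ) ^ k) * ((k : ℝ) ^ 2 / ((b : ℝ) ^ k) ^ 2) := by
    rw [inv_pow]
    field_simp
  rw [e1, e2]
  gcongr

lemma ae_tendsto_blocksPgf_sub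
    {b : ℕ} (hb : 2 ≤ b) {lam : ℝ} (hlam : 0 ≤ lam) {ν : Measure (ℕ → Fin b)}
    (hν : IsUnifProductMeasure b ν)
    {s : ℝ} (hs : 0 ≤ s) (hs' : s ≤ 1) :
    ∀ᵐ x ∂ν, Tendsto (fun k : ℕ =>
      blocksPgf s (blocks (numBlocks b lam k) (k ^ 2 + k) x)
        - Real.exp (-((1 - s) * (numBlocks b lam k * ((k ^ 2 : ℕ) / (b : ℝ) ^ k)))))
      atTop (𝓝 0) := by
  have : NeZero b := ⟨by omega⟩
  have hb1 : (1 : ℝ) < b := by exact_mod_cast hb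
  let g : ℕ → ℝ := fun k =>
    Real.exp (-((1 - s) * (numBlocks b lam k * ((k ^ 2 : ℕ) / (b : ℝ) ^ k))))
  let F : (k : ℕ) → (Fin (numBlocks b lam k) → Fin (k ^ 2 + k) → Fin b) → ℝ :=
    fun k p => (blocksPgf s p - g k) ^ 2
  have hsum : Summable fun k : ℕ => 21 * (lam * ((k : ℝ) ^ 2 * ((b : ℝ)⁻¹) ^ k)) := by
    have hnorm : ‖(b : ℝ)⁻¹‖ < 1 := by
      rw [norm_inv, Real.norm_of_nonneg (by positivity)]
      exact inv_lt_one_of_one_lt₀ hb1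
    exact ((summable_pow_mul_geometric_of_norm_lt_one (R := ℝ) 2 hnorm).mul_left lam).mul_left 21
  have hmeas : ∀ k, Measurable fun x : ℕ → Fin b =>
      ENNReal.ofReal (F k (blocks (numBlocks b lam k) (k ^ 2 + k) x)) := by
    intro k
    refine (measurable_of_finite fun p => ENNReal.ofReal (F k p)).comp ?_
    exact measurable_pi_lambda _ fun i => measurable_pi_lambda _ fun t => measurable_pi_apply _
  have hint : ∫⁻ x, ∑' k, ENNReal.ofReal (F k (blocks (numBlocks b lam k) (k ^ 2 + k) x)) ∂ν
      ≠ ⊤ := by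
    rw [lintegral_tsum fun k => (hmeas k).aemeasurable]
    refine ne_top_of_le_ne_top hsum.tsum_ofReal_ne_top (ENNReal.tsum_le_tsum fun k => ?_)
    rw [lintegral_blocks hν _ _ (f := F k) fun p => sq_nonneg _]
    refine ENNReal.ofReal_le_ofReal ((expect_blocksPgf_sub_sq_le hs hs').trans ?_)
    exact mul_le_mul_of_nonneg_left (numBlocks_mul_sq_le hlam k (by omega)) (by norm_num)
  filter_upwards [ae_lt_top' (AEMeasurable.tsum fun k => (hmeas k).aemeasurable) hint]
    with x hx
  have h1 := (ENNReal.tendsto_toReal ENNReal.zero_ne_top).comp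
    (ENNReal.tendsto_atTop_zero_of_tsum_ne_top hx.ne)
  have h2 : Tendsto (fun k => F k (blocks (numBlocks b lam k) (k ^ 2 + k) x)) atTop (𝓝 0) := by
    refine h1.congr fun k => ?_
    exact ENNReal.toReal_ofReal (sq_nonneg _)
  have h3 := h2.sqrt
  simp only [F, Real.sqrt_sq_eq_abs, Real.sqrt_zero] at h3
  exact (tendsto_zero_iff_abs_tendsto_zero _).2 h3

lemma ae_tendsto_occPgf
    {b : ℕ} (hb : 2 ≤ b) {lam : ℝ} (hlam : 0 ≤ lam) {ν : Measure (ℕ → Fin b)}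
    (hν : IsUnifProductMeasure b ν)
    {s : ℝ} (hs : 0 ≤ s) (hs' : s ≤ 1) :
    ∀ᵐ x ∂ν, Tendsto (fun k : ℕ => occPgf k ⌊lam * (b : ℝ) ^ k⌋₊ s x) atTop
      (𝓝 (Real.exp (-((1 - s) * lam)))) := by
  have : NeZero b := ⟨by omega⟩
  filter_upwards [ae_tendsto_blocksPgf_sub hb hlam hν hs hs'] with x hx
  have hm := tendsto_numBlocks_mul hb hlam
  have hgap := (tendsto_floor_div hb hlam).sub hm
  rw [sub_self] at hgap
  have h1 : Tendsto (fun k : ℕ => occPgf k ⌊lam * (b : ℝ) ^ k⌋₊ s x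
      - blocksPgf s (blocks (numBlocks b lam k) (k ^ 2 + k) x)) atTop (𝓝 0) :=
    squeeze_zero_norm (fun k => abs_occPgf_sub_blocksPgf_le (Nat.div_mul_le_self _ _) hs hs' x)
      hgap
  have h2 := (Real.continuous_exp.tendsto _).comp ((hm.const_mul (1 - s)).neg)
  simpa [Function.comp_def] using (h1.add hx).add h2

lemma occPgf_antitone {b k M N : ℕ} (h : M ≤ N) {s : ℝ} (hs : 0 ≤ s) (hs' : s ≤ 1)
    (x : ℕ → Fin b) : occPgf k N s x ≤ occPgf k M s x :=
  expect_le_expect fun _ _ => pow_le_pow_of_le_one hs hs' <| card_le_card <|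
    filter_subset_filter _ <| Icc_subset_Icc_right h

lemma tendsto_occPgf_of_rat {b : ℕ} {s : ℝ} (hs : 0 ≤ s) (hs' : s ≤ 1) {x : ℕ → Fin b}
    (h : ∀ r : ℚ, 0 < r → Tendsto (fun k : ℕ => occPgf k ⌊(r : ℝ) * (b : ℝ) ^ k⌋₊ s x) atTop
      (𝓝 (Real.exp (-((1 - s) * r))))) {lam : ℝ} (hlam : 0 < lam) :
    Tendsto (fun k : ℕ => occPgf k ⌊lam * (b : ℝ) ^ k⌋₊ s x) atTop
      (𝓝 (Real.exp (-((1 - s) * lam)))) := by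
  have hcont : Continuous fun r : ℝ => Real.exp (-((1 - s) * r)) := by fun_prop
  have hmono : ∀ {r r' : ℝ}, r ≤ r' → ∀ k : ℕ,
      occPgf k ⌊r' * (b : ℝ) ^ k⌋₊ s x ≤ occPgf k ⌊r * (b : ℝ) ^ k⌋₊ s x := fun hr k =>
    occPgf_antitone (Nat.floor_le_floor (mul_le_mul_of_nonneg_right hr (by positivity))) hs hs' x
  refine tendsto_order.2 ⟨fun a ha => ?_, fun a ha => ?_⟩
  · obtain ⟨l, u, ⟨hl, hu⟩, hlu⟩ := mem_nhds_iff_exists_Ioo_subset.1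
      ((hcont.tendsto lam).eventually (lt_mem_nhds ha))
    obtain ⟨r, hr, hru⟩ := exists_rat_btwn hu
    have har : a < Real.exp (-((1 - s) * (r : ℝ))) := hlu ⟨hl.trans hr, hru⟩
    have hr0 : 0 < r := by exact_mod_cast hlam.trans hr
    filter_upwards [(h r hr0).eventually (lt_mem_nhds har)] with k hk
    exact hk.trans_le (hmono hr.le k)
  · obtain ⟨l, u, ⟨hl, hu⟩, hlu⟩ := mem_nhds_iff_exists_Ioo_subset.1
      ((hcont.tendsto lam).eventually (gt_mem_nhds ha))
    obtain ⟨r, hr, hru⟩ := exists_rat_btwn (max_lt hl hlam)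
    have har : Real.exp (-((1 - s) * (r : ℝ))) < a :=
      hlu ⟨(le_max_left _ _).trans_lt hr, hru.trans hu⟩
    have hr0 : 0 < r := by exact_mod_cast (le_max_right _ _).trans_lt hr
    filter_upwards [(h r hr0).eventually (gt_mem_nhds har)] with k hk
    exact (hmono hru.le k).trans_lt hk

/-! ### From generating functions to their coefficients -/

lemma tendsto_coeff_of_tendsto_pgf {a : ℕ → ℕ → ℝ} {c : ℕ → ℝ} {G : ℝ → ℕ → ℝ} {g : ℝ → ℝ}
    {σ : ℕ → ℝ} (hσ : ∀ n, 0 < σ n) (hσ0 : Tendsto σ atTop (𝓝 0))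
    (hG : ∀ n, Tendsto (G (σ n)) atTop (𝓝 (g (σ n))))
    (ha : ∀ n k i, |G (σ n) k - ∑ j ∈ range (i + 1), a k j * σ n ^ j| ≤ σ n ^ (i + 1))
    (hc : ∀ n i, |g (σ n) - ∑ j ∈ range (i + 1), c j * σ n ^ j| ≤ σ n ^ (i + 1)) (i : ℕ) :
    Tendsto (fun k => a k i) atTop (𝓝 (c i)) := by
  induction i using Nat.strong_induction_on with
  | _ i ih =>
    rw [Metric.tendsto_nhds]
    intro ε hε
    obtain ⟨n, hn⟩ := (hσ0.eventually (gt_mem_nhds (show (0 : ℝ) < ε / 4 by positivity))).exists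
    have hpos : 0 < σ n ^ i := pow_pos (hσ n) i
    have hR : Tendsto (fun k => (G (σ n) k - g (σ n))
        - ∑ j ∈ range i, (a k j - c j) * σ n ^ j) atTop (𝓝 0) := by
      have h1 : Tendsto (fun k => G (σ n) k - g (σ n)) atTop (𝓝 0) := by
        simpa using (hG n).sub_const (g (σ n))
      have h2 : Tendsto (fun k => ∑ j ∈ range i, (a k j - c j) * σ n ^ j) atTop (𝓝 0) := by
        have : ∀ j ∈ range i, Tendsto (fun k => (a k j - c j) * σ n ^ j) atTop (𝓝 0) := by
          intro j hj
          simpa using ((ih j (mem_range.1 hj)).sub_const (c j)).mul_const (σ n ^ j)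
        simpa using tendsto_finsetSum _ this
      simpa using h1.sub h2
    have hsmall := (tendsto_zero_iff_abs_tendsto_zero _).1 hR
    filter_upwards [hsmall.eventually
      (gt_mem_nhds (show (0 : ℝ) < ε / 2 * σ n ^ i by positivity))] with k hk
    have h1 := ha n k i
    have h2 := hc n i
    rw [sum_range_succ] at h1 h2
    simp only [Function.comp_apply, sub_mul, sum_sub_distrib] at hk
    rw [abs_le] at h1 h2
    rw [abs_lt] at hk
    have h3 : σ n ^ (i + 1) < ε / 4 * σ n ^ i := by
      rw [pow_succ']
      exact mul_lt_mul_of_pos_right hn hpos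
    rw [Real.dist_eq, abs_lt]
    constructor
    · refine lt_of_mul_lt_mul_right ?_ hpos.le
      nlinarith
    · refine lt_of_mul_lt_mul_right ?_ hpos.le
      nlinarith

lemma abs_occPgf_sub_sum_Z_le {b : ℕ} [NeZero b] (k : ℕ) (lam : ℝ) {s : ℝ} (hs : 0 ≤ s)
    (hs' : s ≤ 1) (x : ℕ → Fin b) (i : ℕ) :
    |occPgf k ⌊lam * (b : ℝ) ^ k⌋₊ s x - ∑ j ∈ range (i + 1), Z b k j lam x * s ^ j|
      ≤ s ^ (i + 1) := by
  set N := ⌊lam * (b : ℝ) ^ k⌋₊ with hN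
  have hZ : ∀ j, Z b k j lam x = 𝔼 w : Fin k → Fin b, if occCount N x w = j then 1 else 0 := by
    intro j
    rw [Fintype.expect_eq_sum_div_card]
    simp [Z, occCount, hN]
  have hsum : ∑ j ∈ range (i + 1), Z b k j lam x * s ^ j
      = 𝔼 w : Fin k → Fin b, if occCount N x w < i + 1 then s ^ occCount N x w else 0 := by
    simp_rw [hZ, expect_mul]
    rw [← expect_sum_comm]
    refine expect_congr rfl fun w _ => ?_
    simp
  rw [hsum, occPgf, ← expect_sub_distrib]
  refine (abs_expect_le _ _).trans (expect_le univ_nonempty fun w _ => ?_)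
  split_ifs with h
  · simpa using pow_nonneg hs (i + 1)
  · rw [sub_zero, abs_of_nonneg (pow_nonneg hs _)]
    exact pow_le_pow_of_le_one hs hs' (not_lt.1 h)

lemma abs_pgf_sub_sum_le {p : ℕ → ℝ} {g s : ℝ} (hp : ∀ j, 0 ≤ p j) (h1 : HasSum p 1)
    (h2 : HasSum (fun j => p j * s ^ j) g) (hs : 0 ≤ s) (hs' : s ≤ 1) (i : ℕ) :
    |g - ∑ j ∈ range (i + 1), p j * s ^ j| ≤ s ^ (i + 1) := by
  have h3 := (hasSum_nat_add_iff' (i + 1)).2 h2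
  have h4 := (hasSum_nat_add_iff' (i + 1)).2 h1
  rw [abs_of_nonneg (h3.nonneg fun j => mul_nonneg (hp _) (pow_nonneg hs _))]
  refine (hasSum_le (fun j => ?_) h3 (h4.mul_right (s ^ (i + 1)))).trans ?_
  · exact mul_le_mul_of_nonneg_left (pow_le_pow_of_le_one hs hs' (Nat.le_add_left _ _)) (hp _)
  · refine mul_le_of_le_one_left (pow_nonneg hs _) ?_
    linarith [sum_nonneg fun j (_ : j ∈ range (i + 1)) => hp j]

lemma hasSum_pow_div_factorial (z : ℝ) :
    HasSum (fun j : ℕ => z ^ j / (j.factorial : ℝ)) (Real.exp z) := by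
  rw [Real.exp_eq_exp_ℝ]
  exact NormedSpace.expSeries_div_hasSum_exp z

lemma abs_exp_sub_sum_poisson_le {lam : ℝ} (hlam : 0 ≤ lam) {s : ℝ} (hs : 0 ≤ s) (hs' : s ≤ 1)
    (i : ℕ) :
    |Real.exp (-((1 - s) * lam))
        - ∑ j ∈ range (i + 1), Real.exp (-lam) * lam ^ j / (j.factorial : ℝ) * s ^ j|
      ≤ s ^ (i + 1) := by
  have h1 : HasSum (fun j : ℕ => Real.exp (-lam) * lam ^ j / (j.factorial : ℝ)) 1 := by
    have := (hasSum_pow_div_factorial lam).mul_left (Real.exp (-lam))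
    rw [← Real.exp_add, neg_add_cancel, Real.exp_zero] at this
    simpa [mul_div_assoc] using this
  have h2 : HasSum (fun j : ℕ => Real.exp (-lam) * lam ^ j / (j.factorial : ℝ) * s ^ j)
      (Real.exp (-((1 - s) * lam))) := by
    have := (hasSum_pow_div_factorial (lam * s)).mul_left (Real.exp (-lam))
    rw [← Real.exp_add] at this
    have hval : -lam + lam * s = -((1 - s) * lam) := by ring
    rw [hval] at this
    refine this.congr_fun fun j => ?_
    rw [mul_pow]
    ring
  exact abs_pgf_sub_sum_le (fun j => by positivity) h1 h2 hs hs' i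

theorem stmt0 (b : ℕ) (hb : 2 ≤ b) (ν : Measure (ℕ → Fin b))
    (hν : IsUnifProductMeasure b ν) :
    ∀ᵐ x ∂ν, PoissonGeneric b x := by
  have : NeZero b := ⟨by omega⟩
  have hσ : ∀ n : ℕ, 0 < 1 / ((n : ℝ) + 1) := fun n => by positivity
  have hσ' : ∀ n : ℕ, 1 / ((n : ℝ) + 1) ≤ 1 := fun n => by
    rw [div_le_one (by positivity)]
    linarith [Nat.cast_nonneg (α := ℝ) n]
  have hae : ∀ᵐ x ∂ν, ∀ (n : ℕ) (r : ℚ), 0 < r →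
      Tendsto (fun k : ℕ => occPgf k ⌊(r : ℝ) * (b : ℝ) ^ k⌋₊ (1 / ((n : ℝ) + 1)) x) atTop
        (𝓝 (Real.exp (-((1 - 1 / ((n : ℝ) + 1)) * r)))) := by
    refine ae_all_iff.2 fun n => ae_all_iff.2 fun r => ?_
    by_cases hr : 0 < r
    · filter_upwards [ae_tendsto_occPgf hb (Rat.cast_nonneg.2 hr.le) hν (hσ n).le (hσ' n)]
        with x hx _ using hx
    · exact Eventually.of_forall fun x h => absurd h hr
  filter_upwards [hae] with x hx lam hlam i
  exact tendsto_coeff_of_tendsto_pgf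
    (G := fun s k => occPgf k ⌊lam * (b : ℝ) ^ k⌋₊ s x)
    (g := fun s => Real.exp (-((1 - s) * lam)))
    (c := fun j => Real.exp (-lam) * lam ^ j / (j.factorial : ℝ))
    hσ tendsto_one_div_add_atTop_nhds_zero_nat
    (fun n => tendsto_occPgf_of_rat (hσ n).le (hσ' n) (hx n) hlam)
    (fun n k i => abs_occPgf_sub_sum_Z_le k lam (hσ n).le (hσ' n) x i)
    (fun n i => abs_exp_sub_sum_poisson_le hlam.le (hσ n).le (hσ' n) i) i
end

section
/- For every fixed real λ > 0, μ^ℕ-almost every x ∈ Ω^ℕ is λ-Poisson generic: for every i ∈ ℕ₀, lim_{k→∞} Z^λ_{i,k}(x) = e^{-λ} λ^i / i!. -/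
open MeasureTheory Filter

namespace PoissonGenericity

/-- The sequence with first symbol `a` followed by `x`. -/
def seqCons {b : ℕ} (a : Fin b) (x : ℕ → Fin b) : ℕ → Fin b
  | 0 => a
  | n + 1 => x n

@[simp] lemma seqCons_zero {b : ℕ} (a : Fin b) (x : ℕ → Fin b) : seqCons a x 0 = a := rfl

@[simp] lemma seqCons_succ {b : ℕ} (a : Fin b) (x : ℕ → Fin b) (n : ℕ) :
    seqCons a x (n + 1) = x n := rfl

/-- Expectation with respect to the uniform measure on the first `n` symbols, the remaining symbols
being set to `0`. -/
noncomputable def prefixMean (b : ℕ) [NeZero b] : ℕ → (((ℕ → Fin b) → ℝ) →ₗ[ℝ] ℝ)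
  | 0 => LinearMap.proj (fun _ => 0)
  | n + 1 => (b : ℝ)⁻¹ • ∑ a : Fin b, (prefixMean b n) ∘ₗ LinearMap.funLeft ℝ ℝ (seqCons a)

section prefixMean

variable {b : ℕ} [NeZero b]

@[simp] lemma prefixMean_zero (f : (ℕ → Fin b) → ℝ) : prefixMean b 0 f = f (fun _ => 0) := rfl

lemma prefixMean_succ (n : ℕ) (f : (ℕ → Fin b) → ℝ) :
    prefixMean b (n + 1) f = (b : ℝ)⁻¹ * ∑ a, prefixMean b n (fun x => f (seqCons a x)) := by
  simp [prefixMean, LinearMap.funLeft, Function.comp_def]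

lemma inv_mul_sum_const (c : ℝ) : (b : ℝ)⁻¹ * ∑ _a : Fin b, c = c := by
  have : (b : ℝ) ≠ 0 := NeZero.ne _
  simp [this]

@[simp] lemma prefixMean_const (n : ℕ) (c : ℝ) : prefixMean b n (fun _ => c) = c := by
  induction n with
  | zero => rfl
  | succ n ih => rw [prefixMean_succ]; simp only [ih, inv_mul_sum_const]

lemma prefixMean_mono (n : ℕ) {f g : (ℕ → Fin b) → ℝ} (h : ∀ x, f x ≤ g x) :
    prefixMean b n f ≤ prefixMean b n g := by
  induction n generalizing f g with
  | zero => exact h _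
  | succ n ih =>
    rw [prefixMean_succ, prefixMean_succ]
    gcongr with a
    exact ih fun x => h _

lemma abs_prefixMean_sub_le (n : ℕ) {f g h : (ℕ → Fin b) → ℝ} (hfg : ∀ x, |f x - g x| ≤ h x) :
    |prefixMean b n f - prefixMean b n g| ≤ prefixMean b n h := by
  rw [← map_sub, abs_le, ← map_neg]
  exact ⟨prefixMean_mono n fun x => (abs_le.1 (hfg x)).1,
    prefixMean_mono n fun x => (abs_le.1 (hfg x)).2⟩

/-- Independence of the first `m` symbols from the subsequent ones. -/
lemma prefixMean_mul_shift (m r : ℕ) {g : (ℕ → Fin b) → ℝ} (hg : DependsOn g (Set.Iio m))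
    (h : (ℕ → Fin b) → ℝ) :
    prefixMean b (m + r) (fun x => g x * h (fun n => x (m + n))) =
      prefixMean b m g * prefixMean b r h := by
  induction m generalizing g with
  | zero =>
    have hc : ∀ x, g x = g (fun _ => 0) := fun x => hg (by simp)
    rw [show (fun x => g x * h fun n => x (0 + n)) = g (fun _ => 0) • h by
      ext x; simp [hc x], map_smul]
    simp
  | succ m ih =>
    rw [show m + 1 + r = (m + r) + 1 by ring, prefixMean_succ, prefixMean_succ, mul_assoc,
      Finset.sum_mul]
    congr 1
    refine Finset.sum_congr rfl fun a _ => ?_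
    rw [← ih]
    · simp only [add_right_comm m 1, seqCons_succ]
    · intro x y hxy
      refine hg fun i hi => ?_
      cases i with
      | zero => rfl
      | succ i => exact hxy i (by simpa using hi)

lemma prefixMean_shift (m r : ℕ) (h : (ℕ → Fin b) → ℝ) :
    prefixMean b (m + r) (fun x => h (fun n => x (m + n))) = prefixMean b r h := by
  simpa using prefixMean_mul_shift m r (g := fun _ => 1) (fun _ _ _ => rfl) h

lemma prefixMean_eq_of_dependsOn (m r : ℕ) {g : (ℕ → Fin b) → ℝ} (hg : DependsOn g (Set.Iio m)) :
    prefixMean b (m + r) g = prefixMean b m g := by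
  simpa using prefixMean_mul_shift m r hg (fun _ => 1)

lemma prefixMean_word (k r : ℕ) (w : Fin k → Fin b) :
    prefixMean b (k + r) (fun x => if ∀ t : Fin k, x t = w t then 1 else 0) = ((b : ℝ) ^ k)⁻¹ := by
  induction k with
  | zero => simp
  | succ k ih =>
    rw [show k + 1 + r = (k + r) + 1 by ring, prefixMean_succ, Finset.sum_eq_single (w 0)]
    · simp only [Fin.forall_fin_succ, Fin.val_zero, seqCons_zero, Fin.val_succ, seqCons_succ,
        true_and, ih, pow_succ, mul_inv]
      ring
    · intro a _ ha
      simp [Fin.forall_fin_succ, ha]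
    · simp

/-- A block of length `k` agrees with its translate by `d + 1` with probability `b ^ (-k)`, whether
or not the two overlap. -/
lemma prefixMean_repeat (k r d : ℕ) :
    prefixMean b (k + r) (fun x => if ∀ t < k, x t = x (t + (d + 1)) then 1 else 0) =
      ((b : ℝ) ^ k)⁻¹ := by
  induction k with
  | zero => simp
  | succ k ih =>
    rw [show k + 1 + r = (k + r) + 1 by ring, prefixMean_succ, ← map_sum, pow_succ, mul_inv,
      mul_comm (_⁻¹), ← ih]
    congr 2
    ext x
    rw [Finset.sum_apply, Finset.sum_eq_single (x d)]
    · congr 1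
      rw [Nat.forall_lt_succ_left]
      simp [← add_assoc, add_right_comm _ 1, seqCons]
    · intro a _ ha
      rw [if_neg]
      intro h
      exact ha (by simpa using h 0 (by simp))
    · simp

/-- A variance bound for functions with bounded differences. -/
lemma prefixMean_variance_le (n : ℕ) {f : (ℕ → Fin b) → ℝ} {c : ℝ}
    (hf : ∀ (j : ℕ) (x y : ℕ → Fin b), (∀ i ≠ j, x i = y i) → |f x - f y| ≤ c) :
    prefixMean b n (fun x => f x ^ 2) - (prefixMean b n f) ^ 2 ≤ n * c ^ 2 := by
  induction n generalizing f with
  | zero => simp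
  | succ n ih =>
    have hb : (0 : ℝ) < b := by exact_mod_cast Nat.pos_of_ne_zero (NeZero.ne b)
    rw [prefixMean_succ, prefixMean_succ]
    set u : Fin b → ℝ := fun a => prefixMean b n fun x => f (seqCons a x) with hu
    have h1 : ∀ a, prefixMean b n (fun x => f (seqCons a x) ^ 2) ≤ n * c ^ 2 + u a ^ 2 := by
      intro a
      have := @ih (fun x => f (seqCons a x)) (by
        intro j x y hxy
        refine hf (j + 1) _ _ fun i hi => ?_
        cases i with
        | zero => rfl
        | succ i => exact hxy i (by simpa using hi))
      linarith
    have h2 : ∀ a, (u a - u 0) ^ 2 ≤ c ^ 2 := by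
      intro a
      refine sq_le_sq' ?_ ?_ <;>
      have := abs_le.1 <| (abs_prefixMean_sub_le n (f := fun x => f (seqCons a x))
        (g := fun x => f (seqCons 0 x)) (h := fun _ => c) (by
          intro x
          refine hf 0 _ _ fun i hi => ?_
          cases i with
          | zero => exact absurd rfl hi
          | succ i => rfl)).trans_eq (prefixMean_const n c)
      exacts [this.1, this.2]
    have h3 : (b : ℝ)⁻¹ * ∑ a, prefixMean b n (fun x => f (seqCons a x) ^ 2) ≤
        n * c ^ 2 + (b : ℝ)⁻¹ * ∑ a, u a ^ 2 := by
      calc _ ≤ (b : ℝ)⁻¹ * ∑ a, (n * c ^ 2 + u a ^ 2) := by gcongr; exact h1 _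
        _ = _ := by rw [Finset.sum_add_distrib, mul_add, inv_mul_sum_const]
    have h4 : (b : ℝ)⁻¹ * ∑ a, (u a - u 0) ^ 2 ≤ c ^ 2 := by
      calc _ ≤ (b : ℝ)⁻¹ * ∑ _a : Fin b, c ^ 2 :=
          mul_le_mul_of_nonneg_left (Finset.sum_le_sum fun a _ => h2 a) (by positivity)
        _ = _ := inv_mul_sum_const _
    have h5 : (b : ℝ)⁻¹ * ∑ a, (u a - u 0) ^ 2 =
        (b : ℝ)⁻¹ * ∑ a, u a ^ 2 - 2 * u 0 * ((b : ℝ)⁻¹ * ∑ a, u a) + u 0 ^ 2 := by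
      simp_rw [sub_sq, Finset.sum_add_distrib, Finset.sum_sub_distrib, mul_add, mul_sub,
        inv_mul_sum_const, ← Finset.sum_mul, ← Finset.mul_sum]
      ring
    push_cast
    nlinarith [sq_nonneg ((b : ℝ)⁻¹ * ∑ a, u a - u 0)]

/-- Extension of a finite word by zeros. -/
def padWord {n : ℕ} (w : Fin n → Fin b) (i : ℕ) : Fin b := if h : i < n then w ⟨i, h⟩ else 0

lemma prefixMean_eq_sum (n : ℕ) (f : (ℕ → Fin b) → ℝ) :
    prefixMean b n f = ((b : ℝ)⁻¹) ^ n * ∑ w : Fin n → Fin b, f (padWord w) := by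
  induction n generalizing f with
  | zero => simp only [prefixMean_zero, pow_zero, one_mul, Fintype.sum_unique]; rfl
  | succ n ih =>
    rw [prefixMean_succ, pow_succ', mul_assoc,
      ← Fintype.sum_equiv (Fin.consEquiv fun _ => Fin b)
        (fun q => f (seqCons q.1 (padWord q.2))) _ ?_, Fintype.sum_prod_type]
    · simp only [ih, Finset.mul_sum]
    · rintro ⟨a, w⟩
      congr 1
      ext i
      cases i with
      | zero => simp [padWord, Fin.consEquiv]
      | succ i => simp [padWord, Fin.consEquiv, Fin.cons]

lemma measure_le_prefixMean {ν : Measure (ℕ → Fin b)} (hν : IsUnifProductMeasure b ν) (n : ℕ)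
    {s : Set (ℕ → Fin b)} (hs : DependsOn (fun x => x ∈ s) (Set.Iio n)) :
    ν s ≤ ENNReal.ofReal (prefixMean b n (s.indicator 1)) := by
  classical
  have hcyl : ∀ (w : Fin n → Fin b) (x : ℕ → Fin b), (∀ t : Fin n, x t = w t) →
      (x ∈ s) = (padWord w ∈ s) := by
    intro w x hx
    refine hs fun i hi => ?_
    simpa [padWord, Set.mem_Iio.1 hi] using hx ⟨i, hi⟩
  have hsub : s ⊆ ⋃ w ∈ Finset.univ.filter (fun w : Fin n → Fin b => padWord w ∈ s),
      {x | ∀ t : Fin n, x (t : ℕ) = w t} := by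
    intro x hx
    simp only [Set.mem_iUnion]
    exact ⟨fun t => x t, by simpa [← hcyl _ x fun _ => rfl] using hx, fun _ => rfl⟩
  refine (measure_mono hsub).trans ((measure_biUnion_finset_le _ _).trans ?_)
  have hb : (0 : ℝ) < b := by exact_mod_cast Nat.pos_of_ne_zero (NeZero.ne b)
  rw [prefixMean_eq_sum, ENNReal.ofReal_mul (by positivity), ENNReal.ofReal_pow (by positivity),
    ENNReal.ofReal_inv_of_pos hb, ENNReal.ofReal_natCast]
  simp only [hν n, Finset.sum_const, nsmul_eq_mul, Set.indicator_apply, Pi.one_apply,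
    Finset.sum_boole, ENNReal.ofReal_natCast]
  rw [mul_comm]

end prefixMean

section counts

variable {b k : ℕ}

/-- Indicator of an occurrence of `w` in `x` at position `n`. -/
def occ (n : ℕ) (w : Fin k → Fin b) (x : ℕ → Fin b) : ℝ := if OccursAt x n w then 1 else 0

/-- Number of occurrences of `w` in `x` at positions `1, …, n`. -/
def cnt (n : ℕ) (w : Fin k → Fin b) (x : ℕ → Fin b) : ℕ :=
  ((Finset.Icc 1 n).filter (fun j => OccursAt x j w)).card

lemma occ_nonneg (n : ℕ) (w : Fin k → Fin b) (x : ℕ → Fin b) : 0 ≤ occ n w x := by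
  unfold occ; split_ifs <;> simp

@[simp] lemma cnt_zero (w : Fin k → Fin b) (x : ℕ → Fin b) : cnt 0 w x = 0 := rfl

lemma cnt_succ (n : ℕ) (w : Fin k → Fin b) (x : ℕ → Fin b) :
    cnt (n + 1) w x = cnt n w x + if OccursAt x (n + 1) w then 1 else 0 := by
  simp only [cnt, Finset.card_filter]
  rw [Finset.sum_Icc_succ_top (by lia)]

lemma dependsOn_cnt {m l : ℕ} (h : m ≠ 0 → m + k ≤ l + 1) (w : Fin k → Fin b) :
    DependsOn (cnt m w) (Set.Iio l) := by
  intro x y hxy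
  unfold cnt
  congr 1
  refine Finset.filter_congr fun j hj => forall_congr' fun t => ?_
  rw [Finset.mem_Icc] at hj
  have := h (by lia)
  rw [hxy _ (by have := t.2; simp only [Set.mem_Iio]; lia)]

lemma abs_comp_cnt_sub_le {h : ℕ → ℝ} (hh : ∀ i, |h i| ≤ 1) {m n : ℕ} (hmn : m ≤ n)
    (w : Fin k → Fin b) (x : ℕ → Fin b) :
    |h (cnt n w x) - h (cnt m w x)| ≤ 2 * ∑ j ∈ Finset.Ioc m n, occ j w x := by
  induction n, hmn using Nat.le_induction with
  | base => simp
  | succ n hmn ih =>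
    rw [← Finset.insert_Ioc_right_eq_Ioc_add_one (by lia), Finset.sum_insert (by simp), cnt_succ]
    by_cases ho : OccursAt x (n + 1) w
    · have hs : 0 ≤ ∑ j ∈ Finset.Ioc m n, occ j w x :=
        Finset.sum_nonneg fun j _ => occ_nonneg j w x
      have h1 := abs_le.1 (hh (cnt n w x + 1))
      have h2 := abs_le.1 (hh (cnt m w x))
      simp only [occ, if_pos ho] at hs ⊢
      rw [abs_le]
      constructor <;> linarith
    · simpa [occ, if_neg ho] using ih

/-- Two words at distinct positions agree with the same word iff they agree with each other. -/
lemma sum_occ_mul_occ (m d : ℕ) (x : ℕ → Fin b) :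
    ∑ w : Fin k → Fin b, occ (m + 1) w x * occ (m + d + 1) w x =
      if ∀ t < k, x (m + t) = x (m + (t + d)) then 1 else 0 := by
  rw [Finset.sum_eq_single (fun t : Fin k => x (m + t))]
  · simp only [occ, OccursAt, add_tsub_cancel_right, implies_true, if_true, one_mul]
    congr 1
    rw [Fin.forall_iff]
    simp only [eq_iff_iff]
    refine forall₂_congr fun t _ => ?_
    rw [show m + (t + d) = m + d + t by ring, eq_comm]
  · intro w _ hw
    rw [occ, if_neg, zero_mul]
    intro h
    exact hw (funext fun t => (by simpa using (h t).symm))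
  · simp

variable [NeZero b]

lemma prefixMean_mul_occ {n M : ℕ} (hM : n + k ≤ M) {g : (ℕ → Fin b) → ℝ}
    (hg : DependsOn g (Set.Iio n)) (w : Fin k → Fin b) :
    prefixMean b M (fun x => g x * occ (n + 1) w x) = prefixMean b M g * ((b : ℝ) ^ k)⁻¹ := by
  obtain ⟨r, rfl⟩ := Nat.exists_eq_add_of_le hM
  rw [add_assoc, prefixMean_eq_of_dependsOn n (k + r) hg, ← prefixMean_word k r w,
    ← prefixMean_mul_shift n (k + r) hg]
  rfl

lemma prefixMean_occ {n M : ℕ} (hM : n + k ≤ M) (w : Fin k → Fin b) :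
    prefixMean b M (occ (n + 1) w) = ((b : ℝ) ^ k)⁻¹ := by
  simpa using prefixMean_mul_occ hM (g := fun _ => 1) (fun _ _ _ => rfl) w

lemma sum_prefixMean_occ_mul_occ {m n M : ℕ} (hmn : m < n) (hM : n + k ≤ M) :
    ∑ w : Fin k → Fin b, prefixMean b M (fun x => occ (m + 1) w x * occ (n + 1) w x) =
      ((b : ℝ) ^ k)⁻¹ := by
  obtain ⟨d, rfl⟩ := Nat.exists_eq_add_of_lt hmn
  obtain ⟨r, rfl⟩ := Nat.exists_eq_add_of_le hM
  rw [← map_sum, ← prefixMean_repeat k (d + 1 + r) d, ← prefixMean_shift m (k + (d + 1 + r)),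
    show m + d + 1 + k + r = m + (k + (d + 1 + r)) by ring]
  congr 1
  ext x
  rw [Finset.sum_apply]
  exact sum_occ_mul_occ m (d + 1) x

lemma abs_prefixMean_cnt_mul_occ_sub_le {n M : ℕ} (hM : n + k ≤ M) {h : ℕ → ℝ}
    (hh : ∀ i, |h i| ≤ 1) (w : Fin k → Fin b) :
    |prefixMean b M (fun x => h (cnt n w x) * occ (n + 1) w x) -
        ((b : ℝ) ^ k)⁻¹ * prefixMean b M (fun x => h (cnt n w x))| ≤
      2 * ∑ j ∈ Finset.Ioc (n + 1 - k) n,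
        (prefixMean b M (fun x => occ j w x * occ (n + 1) w x) + (((b : ℝ) ^ k)⁻¹) ^ 2) := by
  rcases Nat.eq_zero_or_pos k with rfl | hk
  · simp [occ, OccursAt]
  set p : ℝ := ((b : ℝ) ^ k)⁻¹
  have hp : 0 ≤ p := by positivity
  set m := n + 1 - k with hm
  have hmn : m ≤ n := by lia
  have hind : prefixMean b M (fun x => h (cnt m w x) * occ (n + 1) w x) =
      prefixMean b M (fun x => h (cnt m w x)) * p :=
    prefixMean_mul_occ hM (g := fun x => h (cnt m w x))
      (fun x y hxy => congrArg h (dependsOn_cnt (by lia) w hxy)) w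
  have h1 : |prefixMean b M (fun x => h (cnt n w x) * occ (n + 1) w x) -
      prefixMean b M (fun x => h (cnt m w x) * occ (n + 1) w x)| ≤
      2 * ∑ j ∈ Finset.Ioc m n, prefixMean b M (fun x => occ j w x * occ (n + 1) w x) := by
    refine (abs_prefixMean_sub_le M (h := (2 : ℝ) • ∑ j ∈ Finset.Ioc m n,
      fun x => occ j w x * occ (n + 1) w x) fun x => ?_).trans_eq ?_
    · rw [← sub_mul, abs_mul, abs_of_nonneg (occ_nonneg _ _ _)]
      simp only [Pi.smul_apply, Finset.sum_apply, smul_eq_mul, ← Finset.sum_mul, ← mul_assoc]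
      exact mul_le_mul_of_nonneg_right (abs_comp_cnt_sub_le hh hmn w x) (occ_nonneg _ _ _)
    · rw [map_smul, map_sum, smul_eq_mul]
  have h2 : |prefixMean b M (fun x => h (cnt n w x)) - prefixMean b M (fun x => h (cnt m w x))| ≤
      2 * ∑ j ∈ Finset.Ioc m n, p := by
    refine (abs_prefixMean_sub_le M (h := (2 : ℝ) • ∑ j ∈ Finset.Ioc m n, occ j w)
      fun x => ?_).trans_eq ?_
    · simpa using abs_comp_cnt_sub_le hh hmn w x
    · rw [map_smul, map_sum, smul_eq_mul]
      congr 1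
      refine Finset.sum_congr rfl fun j hj => ?_
      rw [Finset.mem_Ioc] at hj
      obtain ⟨j, rfl⟩ := Nat.exists_eq_succ_of_ne_zero (show j ≠ 0 by lia)
      exact prefixMean_occ (by lia) w
  rw [Finset.sum_add_distrib, mul_add]
  have h3 := mul_le_mul_of_nonneg_right h2 hp
  rw [mul_assoc, Finset.sum_mul, ← sq] at h3
  rw [hind] at h1
  rw [← abs_of_nonneg hp, ← abs_mul, abs_of_nonneg hp, sub_mul] at h3
  rw [abs_le] at *
  constructor <;> linarith [h1.1, h1.2, h3.1, h3.2]

/-- Mean of `g` at the number of occurrences among the first `n` positions, for a uniformly random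
word of length `k`. -/
noncomputable def cntMean (b k M n : ℕ) [NeZero b] (g : ℕ → ℝ) : ℝ :=
  ((b : ℝ) ^ k)⁻¹ * ∑ w : Fin k → Fin b, prefixMean b M (fun x => g (cnt n w x))

lemma inv_pow_mul_sum_words_const (c : ℝ) :
    ((b : ℝ) ^ k)⁻¹ * ∑ _w : Fin k → Fin b, c = c := by
  have : (b : ℝ) ≠ 0 := NeZero.ne _
  simp [this]

/-- One step of the binomial transition operator. -/
def binStep (p : ℝ) (g : ℕ → ℝ) (i : ℕ) : ℝ := (1 - p) * g i + p * g (i + 1)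

lemma abs_cntMean_succ_sub_le {n M : ℕ} (hM : n + k ≤ M) {g : ℕ → ℝ}
    (hg : ∀ i, 0 ≤ g i ∧ g i ≤ 1) :
    |cntMean b k M (n + 1) g - cntMean b k M n (binStep ((b : ℝ) ^ k)⁻¹ g)| ≤
      4 * k * (((b : ℝ) ^ k)⁻¹) ^ 2 := by
  set p : ℝ := ((b : ℝ) ^ k)⁻¹ with hp_def
  have hp : 0 ≤ p := by positivity
  set h : ℕ → ℝ := fun i => g (i + 1) - g i with hh_def
  have hh : ∀ i, |h i| ≤ 1 := fun i => by
    rw [abs_le]; constructor <;> linarith [(hg i).1, (hg i).2, (hg (i + 1)).1, (hg (i + 1)).2]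
  have hdiff : ∀ w : Fin k → Fin b,
      prefixMean b M (fun x => g (cnt (n + 1) w x)) -
        prefixMean b M (fun x => binStep p g (cnt n w x)) =
      prefixMean b M (fun x => h (cnt n w x) * occ (n + 1) w x) -
        p * prefixMean b M (fun x => h (cnt n w x)) := by
    intro w
    rw [← smul_eq_mul p, ← map_smul, ← map_sub, ← map_sub]
    congr 1
    ext x
    simp only [Pi.sub_apply, Pi.smul_apply, smul_eq_mul, hh_def, binStep, occ, cnt_succ]
    split_ifs <;> ring_nf
  calc |cntMean b k M (n + 1) g - cntMean b k M n (binStep p g)|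
      = p * |∑ w : Fin k → Fin b,
          (prefixMean b M (fun x => h (cnt n w x) * occ (n + 1) w x) -
            p * prefixMean b M (fun x => h (cnt n w x)))| := by
        rw [← abs_of_nonneg hp, ← abs_mul, abs_of_nonneg hp]
        simp only [← hdiff, Finset.sum_sub_distrib, mul_sub, cntMean, ← hp_def]
    _ ≤ p * ∑ w : Fin k → Fin b, 2 * ∑ j ∈ Finset.Ioc (n + 1 - k) n,
          (prefixMean b M (fun x => occ j w x * occ (n + 1) w x) + p ^ 2) := by
        gcongr
        refine (Finset.abs_sum_le_sum_abs _ _).trans (Finset.sum_le_sum fun w _ => ?_)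
        exact abs_prefixMean_cnt_mul_occ_sub_le hM hh w
    _ = 2 * ∑ j ∈ Finset.Ioc (n + 1 - k) n, (p ^ 2 + p ^ 2) := by
        rw [← Finset.mul_sum, Finset.sum_comm, mul_left_comm, Finset.mul_sum]
        congr 1
        refine Finset.sum_congr rfl fun j hj => ?_
        rw [Finset.mem_Ioc] at hj
        obtain ⟨j, rfl⟩ := Nat.exists_eq_succ_of_ne_zero (show j ≠ 0 by lia)
        rw [Finset.sum_add_distrib, mul_add, inv_pow_mul_sum_words_const,
          sum_prefixMean_occ_mul_occ (by lia) hM, ← sq]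
    _ ≤ 4 * k * p ^ 2 := by
        rw [Finset.sum_const, Nat.card_Ioc, nsmul_eq_mul]
        have : ((n - (n + 1 - k) : ℕ) : ℝ) ≤ k := by exact_mod_cast (by lia)
        nlinarith [sq_nonneg p]

lemma abs_cntMean_sub_iterate_le {n M : ℕ} (hM : n + k ≤ M + 1) {g : ℕ → ℝ}
    (hg : ∀ i, 0 ≤ g i ∧ g i ≤ 1) :
    |cntMean b k M n g - (binStep ((b : ℝ) ^ k)⁻¹)^[n] g 0| ≤
      n * (4 * k * (((b : ℝ) ^ k)⁻¹) ^ 2) := by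
  have hb : (1 : ℝ) ≤ b := by exact_mod_cast Nat.pos_of_ne_zero (NeZero.ne b)
  have hp0 : 0 ≤ ((b : ℝ) ^ k)⁻¹ := by positivity
  have hp1 : ((b : ℝ) ^ k)⁻¹ ≤ 1 := inv_le_one_of_one_le₀ (one_le_pow₀ hb)
  induction n generalizing g with
  | zero => simp only [cntMean, cnt_zero, prefixMean_const, inv_pow_mul_sum_words_const]; simp
  | succ n ih =>
    have h1 := abs_cntMean_succ_sub_le (show n + k ≤ M by lia) hg (b := b)
    have h2 := ih (by lia) (g := binStep ((b : ℝ) ^ k)⁻¹ g) (by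
      intro i
      have h1 := hg i
      have h2 := hg (i + 1)
      unfold binStep
      constructor <;> nlinarith)
    rw [Function.iterate_succ_apply]
    push_cast
    rw [abs_le] at *
    constructor <;> linarith [h1.1, h1.2, h2.1, h2.2]

end counts

lemma binStep_iterate (p : ℝ) (n : ℕ) (g : ℕ → ℝ) (m : ℕ) :
    (binStep p)^[n] g m =
      ∑ j ∈ Finset.range (n + 1), n.choose j * p ^ j * (1 - p) ^ (n - j) * g (m + j) := by
  let S : Module.End ℝ (ℕ → ℝ) := LinearMap.funLeft ℝ ℝ Nat.succ
  have hS : ∀ j (g : ℕ → ℝ) m, (S ^ j) g m = g (m + j) := by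
    intro j
    induction j with
    | zero => simp
    | succ j ih =>
      intro g m
      rw [pow_succ, Module.End.mul_apply, ih]
      rfl
  have hT : binStep p = ⇑(p • S + (1 - p) • (1 : Module.End ℝ (ℕ → ℝ))) := by
    ext g i
    simp [binStep, S, LinearMap.funLeft]
    ring
  rw [hT, ← Module.End.coe_pow, Commute.add_pow]
  · simp only [smul_pow, one_pow, LinearMap.sum_apply, Finset.sum_apply]
    refine Finset.sum_congr rfl fun j _ => ?_
    rw [← nsmul_eq_mul', LinearMap.smul_apply, Pi.smul_apply, smul_mul_smul_comm, mul_one,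
      LinearMap.smul_apply, Pi.smul_apply, hS]
    simp only [smul_eq_mul, nsmul_eq_mul]
    ring
  · exact ((Commute.one_right S).smul_right _).smul_left _

lemma binStep_iterate_single (p : ℝ) (n i : ℕ) :
    (binStep p)^[n] (fun j => if j = i then 1 else 0) 0 =
      n.choose i * p ^ i * (1 - p) ^ (n - i) := by
  rw [binStep_iterate]
  simp only [zero_add, mul_ite, mul_one, mul_zero, Finset.sum_ite_eq', Finset.mem_range]
  split_ifs with h
  · rfl
  · simp [Nat.choose_eq_zero_of_lt (show n < i by lia)]

lemma Z_eq {b : ℕ} (k i : ℕ) (lam : ℝ) (x : ℕ → Fin b) :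
    Z b k i lam x = ((b : ℝ) ^ k)⁻¹ * ∑ w : Fin k → Fin b,
      if cnt ⌊lam * (b : ℝ) ^ k⌋₊ w x = i then (1 : ℝ) else 0 := by
  rw [Finset.sum_boole, Z, div_eq_inv_mul]
  rfl

lemma dependsOn_Z {b : ℕ} (k i : ℕ) (lam : ℝ) :
    DependsOn (Z b k i lam) (Set.Iio (⌊lam * (b : ℝ) ^ k⌋₊ + k)) := by
  intro x y hxy
  rw [Z_eq, Z_eq]
  congr 1
  refine Finset.sum_congr rfl fun w _ => ?_
  rw [dependsOn_cnt (by lia) w hxy]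

lemma prefixMean_Z {b : ℕ} [NeZero b] (k i : ℕ) (lam : ℝ) (M : ℕ) :
    prefixMean b M (Z b k i lam) =
      cntMean b k M ⌊lam * (b : ℝ) ^ k⌋₊ (fun j => if j = i then 1 else 0) := by
  rw [cntMean, ← map_sum, ← smul_eq_mul, ← map_smul]
  congr 1
  ext x
  rw [Z_eq, Pi.smul_apply, Finset.sum_apply, smul_eq_mul]

lemma abs_Z_sub_le {b : ℕ} (k i : ℕ) (lam : ℝ) (j : ℕ) (x y : ℕ → Fin b)
    (hxy : ∀ l ≠ j, x l = y l) :
    |Z b k i lam x - Z b k i lam y| ≤ 2 * k * ((b : ℝ) ^ k)⁻¹ := by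
  classical
  let window : (ℕ → Fin b) → ℕ → Fin k → Fin b := fun z t u => z (j - t + u)
  let B : Finset (Fin k → Fin b) :=
    (Finset.range k).image (window x) ∪ (Finset.range k).image (window y)
  have hB : B.card ≤ 2 * k := by
    refine (Finset.card_union_le _ _).trans ?_
    have h1 := Finset.card_image_le (s := Finset.range k) (f := window x)
    have h2 := Finset.card_image_le (s := Finset.range k) (f := window y)
    rw [Finset.card_range] at h1 h2
    lia
  have hmem : ∀ (z : ℕ → Fin b) (n : ℕ) (w : Fin k → Fin b), OccursAt z n w → n - 1 ≤ j →
      j < n - 1 + k → w ∈ (Finset.range k).image (window z) := by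
    intro z n w h h1 h2
    refine Finset.mem_image.2 ⟨j - (n - 1), Finset.mem_range.2 (by lia), funext fun u => ?_⟩
    rw [← h u]
    simp only [window]
    congr 1
    lia
  have hocc : ∀ w ∉ B, ∀ n, OccursAt x n w ↔ OccursAt y n w := by
    intro w hw n
    simp only [B, Finset.mem_union, not_or] at hw
    by_cases hj : n - 1 ≤ j ∧ j < n - 1 + k
    · exact iff_of_false (fun h => hw.1 (hmem x n w h hj.1 hj.2))
        (fun h => hw.2 (hmem y n w h hj.1 hj.2))
    · refine forall_congr' fun t => ?_
      rw [hxy _ (by have := t.2; lia)]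
  have hb : (0 : ℝ) ≤ ((b : ℝ) ^ k)⁻¹ := by positivity
  rw [Z_eq, Z_eq, ← mul_sub, ← Finset.sum_sub_distrib, abs_mul, abs_of_nonneg hb, mul_comm]
  gcongr
  calc _ ≤ ∑ w : Fin k → Fin b, if w ∈ B then (1 : ℝ) else 0 := by
        refine (Finset.abs_sum_le_sum_abs _ _).trans (Finset.sum_le_sum fun w _ => ?_)
        split_ifs with h1 h2 h3 h4 h5 h6 <;> try norm_num
        all_goals
          have : cnt ⌊lam * (b : ℝ) ^ k⌋₊ w x = cnt ⌊lam * (b : ℝ) ^ k⌋₊ w y := by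
            simp only [cnt, hocc w ‹_›]
          lia
    _ = B.card := by simp
    _ ≤ 2 * k := by exact_mod_cast hB

lemma prefixMean_deviation_le {b : ℕ} [NeZero b] (M : ℕ) (f : (ℕ → Fin b) → ℝ) {ε : ℝ}
    (hε : 0 < ε) :
    prefixMean b M ({x | ε ≤ |f x - prefixMean b M f|}.indicator 1) ≤
      (prefixMean b M (fun x => f x ^ 2) - prefixMean b M f ^ 2) / ε ^ 2 := by
  set m := prefixMean b M f with hm
  rw [le_div_iff₀ (by positivity), mul_comm, ← smul_eq_mul, ← map_smul]
  calc _ ≤ prefixMean b M (fun x => (f x - m) ^ 2) := by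
        refine prefixMean_mono M fun x => ?_
        rw [Pi.smul_apply, Set.indicator_apply]
        split_ifs with h
        · rw [← sq_abs (f x - m)]
          simpa using pow_le_pow_left₀ hε.le h 2
        · simpa using sq_nonneg _
    _ = prefixMean b M ((fun x => f x ^ 2) - (2 * m) • f + fun _ => m ^ 2) := by
        congr 1
        ext x
        simp only [Pi.add_apply, Pi.sub_apply, Pi.smul_apply, smul_eq_mul]
        ring
    _ = _ := by
        rw [map_add, map_sub, map_smul, prefixMean_const, ← hm, smul_eq_mul]
        ring

lemma tendsto_inv_pow {b : ℕ} (hb : 2 ≤ b) :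
    Tendsto (fun k : ℕ => ((b : ℝ) ^ k)⁻¹) atTop (nhds 0) :=
  (tendsto_pow_atTop_atTop_of_one_lt (by exact_mod_cast hb)).inv_tendsto_atTop

lemma tendsto_floor_mul_inv_pow {b : ℕ} (hb : 2 ≤ b) {lam : ℝ} (hlam : 0 < lam) :
    Tendsto (fun k : ℕ => (⌊lam * (b : ℝ) ^ k⌋₊ : ℝ) * ((b : ℝ) ^ k)⁻¹) atTop (nhds lam) :=
  (tendsto_nat_floor_mul_div_atTop hlam.le).comp
    (tendsto_pow_atTop_atTop_of_one_lt (r := (b : ℝ)) (by exact_mod_cast hb))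

open scoped Asymptotics in
/-- The Poisson limit theorem for `⌊λ b ^ k⌋` trials of success probability `b ^ (-k)`. -/
lemma tendsto_binomial {b : ℕ} (hb : 2 ≤ b) {lam : ℝ} (hlam : 0 < lam) (i : ℕ) :
    Tendsto (fun k : ℕ => ((⌊lam * (b : ℝ) ^ k⌋₊).choose i : ℝ) * (((b : ℝ) ^ k)⁻¹) ^ i *
        (1 - ((b : ℝ) ^ k)⁻¹) ^ (⌊lam * (b : ℝ) ^ k⌋₊ - i)) atTop
      (nhds (Real.exp (-lam) * lam ^ i / (Nat.factorial i : ℝ))) := by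
  have hb1 : (1 : ℝ) < b := by exact_mod_cast hb
  set N : ℕ → ℕ := fun k => ⌊lam * (b : ℝ) ^ k⌋₊ with hN
  set p : ℕ → ℝ := fun k => ((b : ℝ) ^ k)⁻¹ with hp
  have hNp : Tendsto (fun k => (N k : ℝ) * p k) atTop (nhds lam) :=
    tendsto_floor_mul_inv_pow hb hlam
  have hp0 : Tendsto p atTop (nhds 0) := tendsto_inv_pow hb
  have hN_top : Tendsto N atTop atTop :=
    tendsto_nat_floor_atTop.comp ((tendsto_pow_atTop_atTop_of_one_lt hb1).const_mul_atTop hlam)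
  have hp1 : ∀ᶠ k in atTop, p k < 1 := hp0.eventually (Iio_mem_nhds one_pos)
  have hchoose : Tendsto (fun k => ((N k).choose i : ℝ) * p k ^ i) atTop
      (nhds (lam ^ i / (Nat.factorial i : ℝ))) := by
    have he : (fun k => ((N k).choose i : ℝ) * p k ^ i) ~[atTop]
        (fun k => ((N k : ℝ) ^ i / (Nat.factorial i : ℝ)) * p k ^ i) :=
      ((isEquivalent_choose i).comp_tendsto hN_top).mul Asymptotics.IsEquivalent.refl
    refine he.tendsto_nhds_iff.2 (((hNp.pow i).div_const _).congr fun k => ?_)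
    rw [mul_pow]
    ring
  have hexp : Tendsto (fun k => (1 - p k) ^ N k) atTop (nhds (Real.exp (-lam))) := by
    have h1 : Tendsto (fun k : ℕ => (1 - p k) ^ (b ^ k)) atTop (nhds (Real.exp (-1))) := by
      refine ((Real.tendsto_one_add_div_pow_exp (-1)).comp
        (tendsto_pow_atTop_atTop_of_one_lt (r := b) (by lia))).congr fun k => ?_
      simp only [Function.comp_apply, hp, Nat.cast_pow]
      ring
    have h2 := h1.rpow hNp (Or.inl (Real.exp_pos _).ne')
    rw [← Real.exp_mul, neg_one_mul] at h2
    refine h2.congr' ?_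
    filter_upwards [hp1] with k hk
    rw [← Real.rpow_natCast, ← Real.rpow_mul (by linarith), ← Real.rpow_natCast]
    congr 1
    have : (b : ℝ) ^ k ≠ 0 := by positivity
    simp only [hp, Nat.cast_pow]
    field_simp
  have hpow : Tendsto (fun k => (1 - p k) ^ (N k - i)) atTop (nhds (Real.exp (-lam))) := by
    have h1 : Tendsto (fun k => (1 - p k) ^ i) atTop (nhds 1) := by
      simpa using (hp0.const_sub 1).pow i
    have h2 := hexp.div h1 one_ne_zero
    rw [div_one] at h2
    refine h2.congr' ?_
    filter_upwards [hp1, hN_top.eventually_ge_atTop i] with k hk hi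
    rw [pow_sub₀ _ (by linarith) hi]
    rfl
  convert hchoose.mul hpow using 2
  ring

lemma summable_pow_mul_inv_pow {b : ℕ} (hb : 2 ≤ b) (m : ℕ) :
    Summable (fun k : ℕ => (k : ℝ) ^ m * ((b : ℝ) ^ k)⁻¹) := by
  have hb1 : (1 : ℝ) < b := by exact_mod_cast hb
  simpa [inv_pow] using summable_pow_mul_geometric_of_norm_lt_one m
    (r := (b : ℝ)⁻¹) (by rw [norm_inv, Real.norm_natCast]; exact inv_lt_one_of_one_lt₀ hb1)

lemma tendsto_prefixMean_Z {b : ℕ} [NeZero b] (hb : 2 ≤ b) {lam : ℝ} (hlam : 0 < lam) (i : ℕ) :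
    Tendsto (fun k : ℕ => prefixMean b (⌊lam * (b : ℝ) ^ k⌋₊ + k) (Z b k i lam)) atTop
      (nhds (Real.exp (-lam) * lam ^ i / (Nat.factorial i : ℝ))) := by
  refine (tendsto_binomial hb hlam i).congr_dist (squeeze_zero (fun _ => dist_nonneg)
    (g := fun k : ℕ => (⌊lam * (b : ℝ) ^ k⌋₊ : ℝ) * ((b : ℝ) ^ k)⁻¹ *
      (4 * ((k : ℝ) ^ 1 * ((b : ℝ) ^ k)⁻¹))) (fun k => ?_) ?_)
  · rw [dist_comm, Real.dist_eq, prefixMean_Z, ← binStep_iterate_single]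
    refine (abs_cntMean_sub_iterate_le (by lia) fun j => ?_).trans_eq (by ring)
    split_ifs <;> simp
  · simpa using (tendsto_floor_mul_inv_pow hb hlam).mul
      ((summable_pow_mul_inv_pow hb 1).tendsto_atTop_zero.const_mul 4)

lemma measure_deviation_le {b : ℕ} [NeZero b] {ν : Measure (ℕ → Fin b)}
    (hν : IsUnifProductMeasure b ν) (hb : 2 ≤ b) {lam : ℝ} (hlam : 0 < lam) (i k : ℕ) {ε : ℝ}
    (hε : 0 < ε) :
    ν {x | ε ≤ |Z b k i lam x - prefixMean b (⌊lam * (b : ℝ) ^ k⌋₊ + k) (Z b k i lam)|} ≤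
      ENNReal.ofReal (4 * (lam + 1) / ε ^ 2 * ((k : ℝ) ^ 2 * ((b : ℝ) ^ k)⁻¹)) := by
  refine (measure_le_prefixMean hν (⌊lam * (b : ℝ) ^ k⌋₊ + k) ?_).trans
    (ENNReal.ofReal_le_ofReal ((prefixMean_deviation_le _ _ hε).trans ?_))
  · intro x y hxy
    simp only [Set.mem_ofPred_eq, dependsOn_Z k i lam hxy]
  · have hvar := prefixMean_variance_le (⌊lam * (b : ℝ) ^ k⌋₊ + k) (abs_Z_sub_le (b := b) k i lam)
    have hbk : (0 : ℝ) < (b : ℝ) ^ k := by positivity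
    have hM : ((⌊lam * (b : ℝ) ^ k⌋₊ + k : ℕ) : ℝ) ≤ (lam + 1) * (b : ℝ) ^ k := by
      have h1 : (⌊lam * (b : ℝ) ^ k⌋₊ : ℝ) ≤ lam * (b : ℝ) ^ k := Nat.floor_le (by positivity)
      have h2 : (k : ℝ) ≤ (b : ℝ) ^ k := by exact_mod_cast (Nat.lt_pow_self (by lia)).le
      push_cast
      linarith
    rw [div_mul_eq_mul_div]
    gcongr
    calc _ ≤ _ := hvar
      _ ≤ (lam + 1) * (b : ℝ) ^ k * (2 * k * ((b : ℝ) ^ k)⁻¹) ^ 2 := by gcongr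
      _ = _ := by field_simp; ring

end PoissonGenericity

open PoissonGenericity in
theorem stmt2 (b : ℕ) (hb : 2 ≤ b) (ν : Measure (ℕ → Fin b))
    (hν : IsUnifProductMeasure b ν) (lam : ℝ) (hlam : 0 < lam) :
    ∀ᵐ x ∂ν, LamPoissonGeneric b lam x := by
  have : NeZero b := ⟨by lia⟩
  unfold LamPoissonGeneric
  rw [ae_all_iff]
  intro i
  have hdev : ∀ q : ℕ, ∀ᵐ x ∂ν, ∀ᶠ k in atTop,
      |Z b k i lam x - prefixMean b (⌊lam * (b : ℝ) ^ k⌋₊ + k) (Z b k i lam)| <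
        1 / ((q : ℝ) + 1) := by
    intro q
    have hsum := ((summable_pow_mul_inv_pow hb 2).mul_left
      (4 * (lam + 1) / (1 / ((q : ℝ) + 1)) ^ 2)).tsum_ofReal_ne_top
    filter_upwards [ae_eventually_notMem (ne_top_of_le_ne_top hsum (ENNReal.tsum_le_tsum fun k =>
      measure_deviation_le hν hb hlam i k Nat.one_div_pos_of_nat))] with x hx
    filter_upwards [hx] with k hk
    simpa using hk
  filter_upwards [ae_all_iff.2 hdev] with x hx
  refine (tendsto_prefixMean_Z hb hlam i).congr_dist (Metric.tendsto_nhds.2 fun ε hε => ?_)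
  obtain ⟨q, hq⟩ := exists_nat_one_div_lt hε
  filter_upwards [hx q] with k hk
  rw [Real.dist_0_eq_abs, abs_of_nonneg dist_nonneg, dist_comm, Real.dist_eq]
  exact hk.trans hq
end

section
/- Let S ⊆ [0,∞) be a finite union of n disjoint bounded intervals with rational endpoints. Then the expectation of M_k(S) with respect to μ^ℕ × μ^k equals b^{−k}·#(ℕ ∩ b^k S), satisfies |E[M_k(S)] − |S|| ≤ 2n·b^{−k}, and converges to |S| as k → ∞. -/
open MeasureTheory Filter

/-- S ⊆ [0,∞) is a finite union of pairwise disjoint intervals with rational endpoints. -/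
def IsFinRatIntervalUnion (S : Set ℝ) : Prop :=
  ∃ (n : ℕ) (p q : Fin n → ℚ), (∀ m, 0 ≤ p m) ∧
    (Pairwise fun m l : Fin n =>
      Disjoint (Set.Ioo ((p m : ℝ)) ((q m : ℝ))) (Set.Ioo ((p l : ℝ)) ((q l : ℝ)))) ∧
    S = ⋃ m, Set.Ioo ((p m : ℝ)) ((q m : ℝ))

/-- Total variation distance between two laws on ℕ (given as set functions). -/
noncomputable def dTV (P Q : Set ℕ → ℝ) : ℝ := ⨆ A : Set ℕ, |P A - Q A|

/-- The law on ℕ of M_k(S) under μ^ℕ × μ^k. -/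
noncomputable def lawM (b k : ℕ) (ν : Measure (ℕ → Fin b)) (S : Set ℝ) (A : Set ℕ) : ℝ :=
  ((ν.prod (muK b k)) {p : (ℕ → Fin b) × (Fin k → Fin b) | Mx b k S p.1 p.2 ∈ A}).toReal

/-- The law on ℕ of M_k^x(S) under μ^k. -/
noncomputable def lawMx (b k : ℕ) (x : ℕ → Fin b) (S : Set ℝ) (A : Set ℕ) : ℝ :=
  ((muK b k) {w : Fin k → Fin b | Mx b k S x w ∈ A}).toReal

/-- The Poisson law with mean λ, as a set function on ℕ. -/
noncomputable def poissonLaw (lam : ℝ) (A : Set ℕ) : ℝ :=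
  ∑' i : A, Real.exp (-lam) * lam ^ (i : ℕ) / (Nat.factorial (i : ℕ) : ℝ)

/-- The positive integers `j` with `j / B` in the open interval `(p, q)`, where `p ≥ 0`. -/
lemma natCast_div_mem_Ioo_iff {B p q : ℝ} (hB : 0 < B) (hp : 0 ≤ p) (j : ℕ) :
    (j : ℝ) / B ∈ Set.Ioo p q ↔ j ∈ Finset.Ioo ⌊p * B⌋₊ ⌈q * B⌉₊ := by
  rw [Finset.mem_Ioo, Nat.floor_lt (by positivity), Nat.lt_ceil, Set.mem_Ioo, lt_div_iff₀ hB,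
    div_lt_iff₀ hB]

lemma abs_card_Ioo_div_sub_volume_le {B p q : ℝ} (hB : 0 < B) (hp : 0 ≤ p) :
    |((Finset.Ioo ⌊p * B⌋₊ ⌈q * B⌉₊).card : ℝ) / B - (volume (Set.Ioo p q)).toReal| ≤ 1 / B := by
  rw [Real.volume_Ioo, Nat.card_Ioo]
  rcases le_or_gt q p with h | h
  · have h₁ : ⌈q * B⌉₊ - ⌊p * B⌋₊ - 1 = 0 := by
      have h₂ : ⌈q * B⌉₊ ≤ ⌊p * B⌋₊ + 1 :=
        (Nat.ceil_mono (mul_le_mul_of_nonneg_right h hB.le)).trans (Nat.ceil_le_floor_add_one _)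
      omega
    rw [h₁, ENNReal.ofReal_of_nonpos (by linarith)]
    simpa using hB.le
  · have hpB : 0 ≤ p * B := by positivity
    have hlt : p * B < q * B := mul_lt_mul_of_pos_right h hB
    have hfc : ⌊p * B⌋₊ < ⌈q * B⌉₊ :=
      Nat.lt_ceil.2 ((Nat.floor_le hpB).trans_lt hlt)
    have hcast : ((⌈q * B⌉₊ - ⌊p * B⌋₊ - 1 : ℕ) : ℝ) = ⌈q * B⌉₊ - ⌊p * B⌋₊ - 1 := by
      rw [Nat.cast_sub (by omega), Nat.cast_sub hfc.le, Nat.cast_one]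
    rw [hcast, ENNReal.toReal_ofReal (by linarith)]
    have hq₁ := Nat.le_ceil (q * B)
    have hq₂ := Nat.ceil_lt_add_one (hpB.trans hlt.le)
    have hp₁ := Nat.floor_le hpB
    have hp₂ := Nat.lt_floor_add_one (p * B)
    rw [show ((⌈q * B⌉₊ : ℝ) - ⌊p * B⌋₊ - 1) / B - (q - p)
      = ((⌈q * B⌉₊ : ℝ) - ⌊p * B⌋₊ - 1 - (q * B - p * B)) / B by field_simp,
      abs_div, abs_of_pos hB]
    gcongr
    rw [abs_le]
    constructor <;> linarith

lemma IsUnifProductMeasure.isProbabilityMeasure {b : ℕ} {ν : Measure (ℕ → Fin b)}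
    (hν : IsUnifProductMeasure b ν) : IsProbabilityMeasure ν :=
  ⟨by simpa using hν 0 Fin.elim0⟩

lemma muK_univ_lt_top {b : ℕ} (hb : b ≠ 0) (k : ℕ) : muK b k Set.univ < ⊤ := by
  rw [muK, Measure.smul_apply, smul_eq_mul]
  exact ENNReal.mul_lt_top (ENNReal.inv_lt_top.2 (by positivity))
    (Measure.count_apply_lt_top.2 (Set.toFinite _))

lemma measurableSet_occursAt (b k j : ℕ) :
    MeasurableSet {pr : (ℕ → Fin b) × (Fin k → Fin b) | OccursAt pr.1 j pr.2} := by
  simp only [OccursAt, Set.ofPred_forall]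
  exact MeasurableSet.iInter fun t => measurableSet_eq_fun (by fun_prop) (by fun_prop)

/-- Exactly one word of length `k` occurs in `x` at position `j`. -/
lemma muK_occursAt {b : ℕ} (k j : ℕ) (x : ℕ → Fin b) :
    muK b k {w | OccursAt x j w} = ((b : ENNReal) ^ k)⁻¹ := by
  have h : {w : Fin k → Fin b | OccursAt x j w} = {fun t : Fin k => x (j - 1 + (t : ℕ))} := by
    ext w
    simp [OccursAt, funext_iff, eq_comm]
  rw [h, muK, Measure.smul_apply, Measure.count_singleton, smul_eq_mul, mul_one]

lemma prod_muK_occursAt {b : ℕ} (hb : b ≠ 0) (ν : Measure (ℕ → Fin b)) [IsProbabilityMeasure ν]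
    (k j : ℕ) :
    (ν.prod (muK b k)) {pr | OccursAt pr.1 j pr.2} = ((b : ENNReal) ^ k)⁻¹ := by
  have : IsFiniteMeasure (muK b k) := ⟨muK_univ_lt_top hb k⟩
  rw [Measure.prod_apply (measurableSet_occursAt b k j)]
  simp only [Set.preimage_ofPred_eq, muK_occursAt, lintegral_const, measure_univ, mul_one]

lemma Mx_eq_sum_indicator {b k : ℕ} {S : Set ℝ} {J : Finset ℕ}
    (hJ : ∀ j : ℕ, j ∈ J ↔ 1 ≤ j ∧ (j : ℝ) / (b : ℝ) ^ k ∈ S)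
    (pr : (ℕ → Fin b) × (Fin k → Fin b)) :
    (Mx b k S pr.1 pr.2 : ℝ) = ∑ j ∈ J, Set.indicator
      {pr : (ℕ → Fin b) × (Fin k → Fin b) | OccursAt pr.1 j pr.2} (fun _ => (1 : ℝ)) pr := by
  have h : {j : ℕ | 1 ≤ j ∧ (j : ℝ) / (b : ℝ) ^ k ∈ S ∧ OccursAt pr.1 j pr.2}
      = ↑(J.filter fun j => OccursAt pr.1 j pr.2) := by
    ext j
    simp [hJ, and_assoc]
  rw [Mx, h, Set.ncard_coe_finset, Finset.card_filter]
  simp [Set.indicator_apply]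

lemma integral_Mx {b : ℕ} (hb : b ≠ 0) (ν : Measure (ℕ → Fin b)) [IsProbabilityMeasure ν]
    {k : ℕ} {S : Set ℝ} {J : Finset ℕ}
    (hJ : ∀ j : ℕ, j ∈ J ↔ 1 ≤ j ∧ (j : ℝ) / (b : ℝ) ^ k ∈ S) :
    ∫ pr : (ℕ → Fin b) × (Fin k → Fin b), (Mx b k S pr.1 pr.2 : ℝ) ∂(ν.prod (muK b k))
      = (J.card : ℝ) / (b : ℝ) ^ k := by
  have : IsFiniteMeasure (muK b k) := ⟨muK_univ_lt_top hb k⟩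
  simp_rw [Mx_eq_sum_indicator hJ]
  rw [integral_finsetSum _ fun j _ =>
    (integrable_const (1 : ℝ)).indicator (measurableSet_occursAt b k j)]
  simp [integral_indicator_const _ (measurableSet_occursAt b k _), measureReal_def,
    prod_muK_occursAt hb, div_eq_mul_inv]

theorem stmt4 (b : ℕ) (hb : 2 ≤ b) (ν : Measure (ℕ → Fin b))
    (hν : IsUnifProductMeasure b ν) (n : ℕ) (p q : Fin n → ℚ)
    (hp : ∀ m, 0 ≤ p m)
    (hdisj : Pairwise fun m l : Fin n =>
      Disjoint (Set.Ioo ((p m : ℝ)) ((q m : ℝ))) (Set.Ioo ((p l : ℝ)) ((q l : ℝ))))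
    (S : Set ℝ) (hS : S = ⋃ m, Set.Ioo ((p m : ℝ)) ((q m : ℝ))) :
    (∀ k : ℕ,
      (∫ pr : (ℕ → Fin b) × (Fin k → Fin b), (Mx b k S pr.1 pr.2 : ℝ) ∂(ν.prod (muK b k)))
        = ({j : ℕ | 1 ≤ j ∧ ((j : ℝ) / (b : ℝ) ^ k) ∈ S}.ncard : ℝ) / (b : ℝ) ^ k) ∧
    (∀ k : ℕ,
      |(∫ pr : (ℕ → Fin b) × (Fin k → Fin b), (Mx b k S pr.1 pr.2 : ℝ) ∂(ν.prod (muK b k)))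
          - (volume S).toReal|
        ≤ 2 * n / (b : ℝ) ^ k) ∧
    Tendsto (fun k : ℕ =>
        ∫ pr : (ℕ → Fin b) × (Fin k → Fin b), (Mx b k S pr.1 pr.2 : ℝ) ∂(ν.prod (muK b k)))
      atTop (nhds (volume S).toReal) := by
  have hb₀ : b ≠ 0 := by omega
  have hB (k : ℕ) : (0 : ℝ) < (b : ℝ) ^ k := by positivity
  have hp' (m : Fin n) : (0 : ℝ) ≤ p m := by exact_mod_cast hp m
  have := hν.isProbabilityMeasure
  let F (k : ℕ) (m : Fin n) : Finset ℕ :=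
    Finset.Ioo ⌊(p m : ℝ) * (b : ℝ) ^ k⌋₊ ⌈(q m : ℝ) * (b : ℝ) ^ k⌉₊
  have hF (k : ℕ) (m : Fin n) (j : ℕ) :
      j ∈ F k m ↔ (j : ℝ) / (b : ℝ) ^ k ∈ Set.Ioo (p m : ℝ) (q m : ℝ) :=
    (natCast_div_mem_Ioo_iff (hB k) (hp' m) j).symm
  have hJ (k j : ℕ) :
      j ∈ Finset.univ.biUnion (F k) ↔ 1 ≤ j ∧ (j : ℝ) / (b : ℝ) ^ k ∈ S := by
    simp only [Finset.mem_biUnion, Finset.mem_univ, true_and, hF, hS, Set.mem_iUnion]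
    refine ⟨fun ⟨m, hm⟩ => ⟨?_, m, hm⟩, fun h => h.2⟩
    exact Nat.one_le_of_lt (Finset.mem_Ioo.1 ((hF k m j).2 hm)).1
  have hcard (k : ℕ) : (Finset.univ.biUnion (F k)).card = ∑ m, (F k m).card := by
    refine Finset.card_biUnion fun m _ l _ hml => Finset.disjoint_left.2 fun j hm hl => ?_
    exact Set.disjoint_left.1 (hdisj hml) ((hF k m j).1 hm) ((hF k l j).1 hl)
  have hvol : (volume S).toReal = ∑ m, (volume (Set.Ioo (p m : ℝ) (q m : ℝ))).toReal := by
    rw [hS, measure_iUnion hdisj fun _ => measurableSet_Ioo, tsum_fintype,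
      ENNReal.toReal_sum fun m _ => by simp]
  have hbound (k : ℕ) :
      |(∫ pr : (ℕ → Fin b) × (Fin k → Fin b), (Mx b k S pr.1 pr.2 : ℝ) ∂(ν.prod (muK b k)))
          - (volume S).toReal| ≤ 2 * n / (b : ℝ) ^ k := by
    rw [integral_Mx hb₀ ν (hJ k), hcard, hvol, Nat.cast_sum, Finset.sum_div,
      ← Finset.sum_sub_distrib]
    calc _ ≤ ∑ m : Fin n, |((F k m).card : ℝ) / (b : ℝ) ^ k
            - (volume (Set.Ioo (p m : ℝ) (q m : ℝ))).toReal| := Finset.abs_sum_le_sum_abs _ _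
      _ ≤ ∑ _m : Fin n, 1 / (b : ℝ) ^ k :=
          Finset.sum_le_sum fun m _ => abs_card_Ioo_div_sub_volume_le (hB k) (hp' m)
      _ = n / (b : ℝ) ^ k := by simp [div_eq_mul_inv]
      _ ≤ 2 * n / (b : ℝ) ^ k := by
          gcongr
          linarith [(Nat.cast_nonneg n : (0 : ℝ) ≤ n)]
  refine ⟨fun k => ?_, hbound, ?_⟩
  · rw [integral_Mx hb₀ ν (hJ k), ← Set.ncard_coe_finset]
    congr 3
    ext j
    exact hJ k j
  · rw [tendsto_iff_dist_tendsto_zero]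
    refine squeeze_zero (fun _ => dist_nonneg) (fun k => (Real.dist_eq _ _).trans_le (hbound k)) ?_
    exact tendsto_const_nhds.div_atTop
      (tendsto_pow_atTop_atTop_of_one_lt (by exact_mod_cast hb))
end
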